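/- arXiv:2605.00697 — 2 statements merged into one kernel-verified Lean document; each statement's English description precedes it below -/
import Mathlib

section
/- Let T be a complete first-order theory with no finite models and no Vaughtian pairs. Then for every formula θ(x, ȳ) there exists n_θ < ω such that for every model M ⊨ T and every tuple b̄ ∈ M^{|ȳ|}: if θ(M, b̄) is finite, then |θ(M, b̄)| ≤ n_θ. In other words, T eliminates the quantifier ∃^∞. -/
open FirstOrder FirstOrder.Language

namespace ArMorley

/-! ## Arithmetical sets and arithmetic reducibility -/

/-- Function symbols of the language of arithmetic: `0`, `1`, `+`, `·`. -/
inductive ArFunc : ℕ → Type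
  | zero : ArFunc 0
  | one : ArFunc 0
  | add : ArFunc 2
  | mul : ArFunc 2

/-- Relation symbols: `<` and a unary oracle predicate. -/
inductive ArRel : ℕ → Type
  | lt : ArRel 2
  | mem : ArRel 1

/-- The language `(+, ·, 0, 1, <, Y)` of arithmetic with a unary oracle predicate. -/
def arithLang : FirstOrder.Language := ⟨ArFunc, ArRel⟩

/-- The standard structure on `ℕ`, with the oracle predicate interpreted by `Y`. -/
def arithStructure (Y : Set ℕ) : arithLang.Structure ℕ where
  funMap := fun {n} f =>
    match f with
    | ArFunc.zero => fun _ => 0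
    | ArFunc.one => fun _ => 1
    | ArFunc.add => fun v => v 0 + v 1
    | ArFunc.mul => fun v => v 0 * v 1
  RelMap := fun {n} r =>
    match r with
    | ArRel.lt => fun v => v 0 < v 1
    | ArRel.mem => fun v => v 0 ∈ Y

/-- `X ≤_ar Y` : `X` is definable without parameters in `(ℕ, +, ·, 0, 1, <, Y)`. -/
def ArReducible (X Y : Set ℕ) : Prop :=
  letI := arithStructure Y
  ∃ φ : arithLang.Formula (Fin 1), X = { n : ℕ | φ.Realize (fun _ => n) }

/-- `X` is arithmetical: definable without parameters in `(ℕ, +, ·, 0, 1, <)`. -/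
def IsArithmetical (X : Set ℕ) : Prop := ArReducible X ∅

/-- `X` and `Y` have the same arithmetic degree. -/
def ArEquiv (X Y : Set ℕ) : Prop := ArReducible X Y ∧ ArReducible Y X

/-! ## Coding conventions -/

/-- Code of a list of naturals. -/
def listCode (l : List ℕ) : ℕ := Encodable.encode l

/-- Code of a finite tuple of naturals. -/
def tupleCode {n : ℕ} (v : Fin n → ℕ) : ℕ := listCode (List.ofFn v)

/-- The subset of `ℕ` corresponding to a set of elements of a coded domain. -/
def subCode {A : Set ℕ} (S : Set ↥A) : Set ℕ := Subtype.val '' S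

/-- Code of a set of `n`-tuples from a coded domain as a subset of `ℕ`. -/
def tupleSetCode {A : Set ℕ} {n : ℕ} (X : Set (Fin n → ↥A)) : Set ℕ :=
  { c : ℕ | ∃ v ∈ X, c = tupleCode (fun i => ((v i : ℕ))) }

/-- Code of the graph of a function between coded domains. -/
def graphCode {A B : Set ℕ} (f : ↥A → ↥B) : Set ℕ :=
  { c : ℕ | ∃ a : ↥A, c = Nat.pair (a : ℕ) ((f a : ℕ)) }

/-! ## Gödel coded languages -/

/-- A fixed Gödel coding of the symbols of a countable first-order language. -/
structure GoedelCoding (L : FirstOrder.Language) where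
  encFun : ∀ n, L.Functions n → ℕ
  encFun_inj : ∀ n, Function.Injective (encFun n)
  encRel : ∀ n, L.Relations n → ℕ
  encRel_inj : ∀ n, Function.Injective (encRel n)

variable {L : FirstOrder.Language}

/-- The set of codes of the symbols of `L`. -/
def symbolCodes (g : GoedelCoding L) : Set ℕ :=
  { c | (∃ (n : ℕ) (f : L.Functions n), c = Nat.pair 0 (Nat.pair n (g.encFun n f))) ∨
        (∃ (n : ℕ) (R : L.Relations n), c = Nat.pair 1 (Nat.pair n (g.encRel n R))) }

/-- `L` is an arithmetically definable language. -/
def ArithLang (g : GoedelCoding L) : Prop := IsArithmetical (symbolCodes g)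

/-- Code of a term, with a given coding of the variables. -/
def termCode (g : GoedelCoding L) {α : Type} (encα : α → ℕ) (t : L.Term α) : ℕ :=
  listCode (t.listEncode.map (Sum.elim (fun a => Nat.pair 0 (encα a))
    (fun p => Nat.pair 1 (Nat.pair p.1 (g.encFun p.1 p.2)))))

/-- Code of a (bounded) formula, with a given coding of free variables. -/
def formulaCode (g : GoedelCoding L) {α : Type} (encα : α → ℕ) {n : ℕ}
    (φ : L.BoundedFormula α n) : ℕ :=
  listCode (φ.listEncode.map (Sum.elim
    (fun p => Nat.pair 0 (Nat.pair p.1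
      (termCode g (Sum.elim (fun a => Nat.pair 0 (encα a)) (fun i => Nat.pair 1 i.1)) p.2)))
    (Sum.elim
      (fun q => Nat.pair 1 (Nat.pair q.1 (g.encRel q.1 q.2)))
      (fun m => Nat.pair 2 m))))

/-- Code of a sentence. -/
def sentenceCode (g : GoedelCoding L) (φ : L.Sentence) : ℕ :=
  formulaCode g (fun a : Empty => a.elim) φ

/-- The set of codes of the axioms of a theory. -/
def theoryCode (g : GoedelCoding L) (T : L.Theory) : Set ℕ :=
  { c | ∃ φ ∈ T, c = sentenceCode g φ }

/-- `T` is an arithmetically definable theory. -/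
def ArithTheory (g : GoedelCoding L) (T : L.Theory) : Prop := IsArithmetical (theoryCode g T)

/-! ## Coded structures -/

/-- A coded `L`-structure: an `L`-structure whose domain is a subset of `ℕ`
with infinite complement. -/
structure CodedStructure (L : FirstOrder.Language) where
  carrier : Set ℕ
  compl_infinite : (carrierᶜ : Set ℕ).Infinite
  struc : L.Structure ↥carrier

/-- A coded structure is a model of `T`. -/
def CodedStructure.Models (M : CodedStructure L) (T : L.Theory) : Prop :=
  ∀ φ ∈ T, @Sentence.Realize L ↥M.carrier M.struc φ

/-- The (coded) elementary diagram of a coded structure. -/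
def elemDiagram (g : GoedelCoding L) (M : CodedStructure L) : Set ℕ :=
  { c | ∃ (k : ℕ) (φ : L.Formula (Fin k)) (a : Fin k → ↥M.carrier),
      c = Nat.pair (Nat.pair k (formulaCode g Fin.val φ)) (tupleCode fun i => ((a i : ℕ))) ∧
      (letI := M.struc; φ.Realize a) }

/-- A coded structure is arithmetically decidable if its elementary diagram is arithmetical. -/
def ArithDecidable (g : GoedelCoding L) (M : CodedStructure L) : Prop :=
  IsArithmetical (elemDiagram g M)

/-- `M ≼ N` for coded structures: `M`'s domain is contained in `N`'s, and the
inclusion is elementary. -/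
structure ElemSub (M N : CodedStructure L) : Prop where
  subset : M.carrier ⊆ N.carrier
  elem : ∀ (k : ℕ) (φ : L.Formula (Fin k)) (a : Fin k → ↥M.carrier),
    (letI := M.struc; φ.Realize a) ↔
      (letI := N.struc; φ.Realize (fun i => (⟨((a i : ℕ)), subset (a i).2⟩ : ↥N.carrier)))

/-- A coded model of `T` is arithmetically extendible if it is an elementary substructure of
an arithmetically decidable coded model of `T`. -/
def ArithExtendible (g : GoedelCoding L) (T : L.Theory) (M : CodedStructure L) : Prop :=
  ∃ N : CodedStructure L, ArithDecidable g N ∧ N.Models T ∧ ElemSub M N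

/-! ## Model-theoretic notions in arbitrary structures -/

/-- `N` (with structure `SN`) is a model of `T`. -/
def ModelsT (L : FirstOrder.Language) (T : L.Theory) (N : Type) (SN : L.Structure N) : Prop :=
  ∀ φ ∈ T, @Sentence.Realize L N SN φ

/-- `T` has no finite models. -/
def NoFiniteModels (L : FirstOrder.Language) (T : L.Theory) : Prop :=
  ∀ (N : Type) (SN : L.Structure N), ModelsT L T N SN → Infinite N

/-- Elementary embeddings, with the structures given explicitly. -/
def EEmb (L : FirstOrder.Language) (M : Type) (SM : L.Structure M)
    (N : Type) (SN : L.Structure N) : Type _ :=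
  @FirstOrder.Language.ElementaryEmbedding L M N SM SN

/-- The underlying map of an elementary embedding. -/
def EEmb.fn {L : FirstOrder.Language} {M : Type} {SM : L.Structure M}
    {N : Type} {SN : L.Structure N} (j : EEmb L M SM N SN) : M → N :=
  @FirstOrder.Language.ElementaryEmbedding.toFun L M N SM SN j

/-- A subset of `N^n` definable with parameters from `P`. -/
def DefinableOverT (L : FirstOrder.Language) (N : Type) (SN : L.Structure N) (P : Set N)
    {n : ℕ} (X : Set (Fin n → N)) : Prop :=
  letI := SN
  ∃ (m : ℕ) (ψ : L.Formula (Fin n ⊕ Fin m)) (b : Fin m → N),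
    (∀ i, b i ∈ P) ∧ X = { v | ψ.Realize (Sum.elim v b) }

/-- A subset of `N` definable with (arbitrary) parameters. -/
def Definable1 (L : FirstOrder.Language) (N : Type) (SN : L.Structure N) (Y : Set N) : Prop :=
  letI := SN
  ∃ (m : ℕ) (ψ : L.Formula (Fin 1 ⊕ Fin m)) (b : Fin m → N),
    Y = { x : N | ψ.Realize (Sum.elim (fun _ => x) b) }

/-- The algebraic closure of `B` in `N`: elements satisfying a formula with parameters
from `B` having finitely many solutions. -/
def aclIn (L : FirstOrder.Language) (N : Type) (SN : L.Structure N) (B : Set N) : Set N :=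
  letI := SN
  { a : N | ∃ (k : ℕ) (φ : L.Formula (Fin 1 ⊕ Fin k)) (b : Fin k → N),
      (∀ i, b i ∈ B) ∧ φ.Realize (Sum.elim (fun _ => a) b) ∧
      { x : N | φ.Realize (Sum.elim (fun _ => x) b) }.Finite }

/-- The domain of the substructure of `N` generated by `B`: values of terms at
arguments from `B`. -/
def genSub (L : FirstOrder.Language) (N : Type) (SN : L.Structure N) (B : Set N) : Set N :=
  letI := SN
  { a : N | ∃ (t : L.Term ℕ) (v : ℕ → N), (∀ i, v i ∈ B) ∧ a = t.realize v }

/-- The set defined by a formula `φ(x, p̄)` in one free variable with parameters `p̄`. -/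
def smSet (L : FirstOrder.Language) (N : Type) (SN : L.Structure N) {k : ℕ}
    (φ : L.Formula (Fin 1 ⊕ Fin k)) (p : Fin k → N) : Set N :=
  letI := SN
  { x : N | φ.Realize (Sum.elim (fun _ => x) p) }

/-- A definable tuple-set in a coded structure, with parameters from `P`. -/
def DefinableOver (M : CodedStructure L) (P : Set ↥M.carrier) {n : ℕ}
    (X : Set (Fin n → ↥M.carrier)) : Prop :=
  DefinableOverT L ↥M.carrier M.struc P X

/-- A definable tuple-set in a coded structure, with arbitrary parameters. -/
def DefinableIn (M : CodedStructure L) {n : ℕ} (X : Set (Fin n → ↥M.carrier)) : Prop :=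
  DefinableOver M Set.univ X

/-! ## Isomorphisms of coded structures and `D`-categoricity -/

/-- An isomorphism of coded `L`-structures. -/
structure CodedIso (M N : CodedStructure L) where
  toFun : ↥M.carrier → ↥N.carrier
  invFun : ↥N.carrier → ↥M.carrier
  left_inv : Function.LeftInverse invFun toFun
  right_inv : Function.RightInverse invFun toFun
  map_fun : ∀ {k : ℕ} (f : L.Functions k) (v : Fin k → ↥M.carrier),
    toFun (M.struc.funMap f v) = N.struc.funMap f (toFun ∘ v)
  map_rel : ∀ {k : ℕ} (r : L.Relations k) (v : Fin k → ↥M.carrier),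
    M.struc.RelMap r v ↔ N.struc.RelMap r (toFun ∘ v)

/-- `f` is a `D`-preserving isomorphism, where `d` is a representative of the
arithmetic degree `D`. -/
def DPreserving (d : Set ℕ) {M N : CodedStructure L} (f : CodedIso M N) : Prop :=
  ArReducible (graphCode f.toFun) d ∧
  ArReducible (graphCode f.invFun) d ∧
  (∀ (n : ℕ) (X : Set (Fin n → ↥M.carrier)), DefinableIn M X →
      ArEquiv (tupleSetCode X) d →
      ArEquiv (tupleSetCode ((fun v => f.toFun ∘ v) '' X)) d) ∧
  (∀ (n : ℕ) (Y : Set (Fin n → ↥N.carrier)), DefinableIn N Y →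
      ArEquiv (tupleSetCode Y) d →
      ArEquiv (tupleSetCode ((fun v => f.invFun ∘ v) '' Y)) d)

/-- `T` is `D`-categorical, where `d` is a representative of the nonzero
arithmetic degree `D`. -/
def DCategorical (g : GoedelCoding L) (T : L.Theory) (d : Set ℕ) : Prop :=
  ∀ M₀ M₁ M₂ : CodedStructure L,
    ArithDecidable g M₀ → M₀.Models T →
    M₁.Models T → ArithExtendible g T M₁ →
    M₂.Models T → ArithExtendible g T M₂ →
    ElemSub M₀ M₁ → ElemSub M₀ M₂ →
    ArEquiv M₁.carrier d → ArEquiv M₂.carrier d →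
    ∃ f : CodedIso M₁ M₂, DPreserving d f ∧
      ∀ (x : ℕ) (hx : x ∈ M₀.carrier) (h₁ : x ∈ M₁.carrier),
        ((f.toFun ⟨x, h₁⟩ : ℕ)) = x

/-! ## Vaughtian pairs, prime models, strong minimality -/

/-- `T` has a Vaughtian pair. -/
def HasVaughtianPair (T : L.Theory) : Prop :=
  ∃ (N : Type) (SN : L.Structure N),
    ModelsT L T N SN ∧
    ∃ S : @FirstOrder.Language.ElementarySubstructure L N SN,
      ((S.toSubstructure : Set N) ≠ Set.univ ∧
      ∃ (k : ℕ) (φ : L.Formula (Fin 1 ⊕ Fin k)) (a : Fin k → N),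
        (∀ i, a i ∈ (S.toSubstructure : Set N)) ∧
        smSet L N SN φ a ⊆ (S.toSubstructure : Set N) ∧
        (smSet L N SN φ a).Infinite)

/-- A coded model of `T` is prime: it elementarily embeds into every model of `T`. -/
def PrimeModel (L : FirstOrder.Language) (T : L.Theory) (P : CodedStructure L) : Prop :=
  P.Models T ∧ ∀ (N : Type) (SN : L.Structure N), ModelsT L T N SN →
    Nonempty (EEmb L ↥P.carrier P.struc N SN)

/-- `φ(x, p̄)` is strongly minimal over the coded model `M`: its solution set in `M` is
infinite, and in every elementary extension of `M` modelling `T` every definable subset of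
its solution set is finite or cofinite in it. -/
def StronglyMinimalOver (T : L.Theory) (M : CodedStructure L) {k : ℕ}
    (φ : L.Formula (Fin 1 ⊕ Fin k)) (p : Fin k → ↥M.carrier) : Prop :=
  (smSet L ↥M.carrier M.struc φ p).Infinite ∧
  ∀ (N : Type) (SN : L.Structure N), ModelsT L T N SN →
    ∀ j : EEmb L ↥M.carrier M.struc N SN,
      ∀ Y : Set N, Definable1 L N SN Y →
        Y ⊆ smSet L N SN φ (fun i => j.fn (p i)) →
        (Y.Finite ∨ ((smSet L N SN φ (fun i => j.fn (p i))) \ Y).Finite)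

/-- `T` is a strongly minimal theory: every model is infinite, and every
parameter-definable subset of any model is finite or cofinite. -/
def StronglyMinimalTheory (L : FirstOrder.Language) (T : L.Theory) : Prop :=
  (∀ (N : Type) (SN : L.Structure N), ModelsT L T N SN → Infinite N) ∧
  (∀ (N : Type) (SN : L.Structure N), ModelsT L T N SN →
    ∀ Y : Set N, Definable1 L N SN Y → (Y.Finite ∨ (Yᶜ : Set N).Finite))

/-- The structural control clause: an arithmetically decidable prime model together with
a strongly minimal formula over it generating every elementary extension. -/
def GeneratesAll (T : L.Theory) (P : CodedStructure L) {k : ℕ}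
    (φ : L.Formula (Fin 1 ⊕ Fin k)) (p : Fin k → ↥P.carrier) : Prop :=
  ∀ (N : Type) (SN : L.Structure N), ModelsT L T N SN →
    ∀ j : EEmb L ↥P.carrier P.struc N SN,
      aclIn L N SN (Set.range j.fn ∪ smSet L N SN φ (fun i => j.fn (p i))) = Set.univ

/-- Clause (3) of the arithmetic Baldwin–Lachlan theorem. -/
def SMControl (g : GoedelCoding L) (T : L.Theory) : Prop :=
  ∃ (P : CodedStructure L), ArithDecidable g P ∧ PrimeModel L T P ∧
    ∃ (k : ℕ) (φ : L.Formula (Fin 1 ⊕ Fin k)) (p : Fin k → ↥P.carrier),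
      StronglyMinimalOver T P φ p ∧ GeneratesAll T P φ p

/-! ## Types and arithmetical stability -/

/-- A formula with a finite parameter tuple from a coded structure, in `n` object
variables. -/
def ParamFormula (L : FirstOrder.Language) (M : CodedStructure L) (n : ℕ) : Type :=
  Σ k : ℕ, L.Formula (Fin n ⊕ Fin k) × (Fin k → ↥M.carrier)

/-- All parameters of `q` lie in `A`. -/
def paramsIn {M : CodedStructure L} {n : ℕ} (A : Set ℕ) (q : ParamFormula L M n) : Prop :=
  ∀ i, ((q.2.2 i : ℕ)) ∈ A

/-- `p` is consistent with the elementary diagram of `M`: it is realized in some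
elementary extension of `M`. -/
def TypeConsistent (M : CodedStructure L) {n : ℕ} (p : Set (ParamFormula L M n)) : Prop :=
  ∃ (N : Type) (SN : L.Structure N) (j : EEmb L ↥M.carrier M.struc N SN) (b : Fin n → N),
    ∀ q ∈ p, letI := SN; q.2.1.Realize (Sum.elim b (fun i => j.fn (q.2.2 i)))

/-- `p` is a (complete) `n`-type over `A` inside `M`: a maximal set of formulas with
parameters from `A` consistent with the elementary diagram of `M`. -/
def IsNType (M : CodedStructure L) (A : Set ℕ) (n : ℕ)
    (p : Set (ParamFormula L M n)) : Prop :=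
  (∀ q ∈ p, paramsIn A q) ∧
  TypeConsistent M p ∧
  ∀ q : ParamFormula L M n, paramsIn A q → q ∉ p → ¬ TypeConsistent M (insert q p)

/-- The code of a formula-with-parameters. -/
def pfCode (g : GoedelCoding L) {M : CodedStructure L} {n : ℕ} (q : ParamFormula L M n) : ℕ :=
  Nat.pair
    (Nat.pair q.1 (formulaCode g
      (Sum.elim (fun i : Fin n => Nat.pair 0 i.1) (fun j : Fin q.1 => Nat.pair 1 j.1)) q.2.1))
    (tupleCode fun i => ((q.2.2 i : ℕ)))

/-- The set of codes of the formulas of `p`. -/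
def typeCode (g : GoedelCoding L) {M : CodedStructure L} {n : ℕ}
    (p : Set (ParamFormula L M n)) : Set ℕ :=
  { c | ∃ q ∈ p, c = pfCode g q }

/-- `p` is realized in the coded elementary extension `N` of `M`. -/
def RealizesType {M N : CodedStructure L} (h : M.carrier ⊆ N.carrier) {n : ℕ}
    (p : Set (ParamFormula L M n)) : Prop :=
  ∃ b : Fin n → ↥N.carrier, ∀ q ∈ p,
    letI := N.struc
    q.2.1.Realize (Sum.elim b (fun i => (⟨((q.2.2 i : ℕ)), h (q.2.2 i).2⟩ : ↥N.carrier)))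

/-- The `(n, i)`-th column of an effective join. -/
def tripleSection (X : Set ℕ) (n i : ℕ) : Set ℕ := { m | Nat.pair n (Nat.pair i m) ∈ X }

/-- `T` is arithmetically stable: over every arithmetically decidable model and every
arithmetical parameter set, the family of arithmetic `n`-types (for all `n ≥ 1`) has a
uniform arithmetical code in which every arithmetic `n`-type appears at least once. -/
def ArithStable (g : GoedelCoding L) (T : L.Theory) : Prop :=
  ∀ M : CodedStructure L, ArithDecidable g M → M.Models T →
    ∀ A : Set ℕ, A ⊆ M.carrier → IsArithmetical A →
      ∃ X : Set ℕ, IsArithmetical X ∧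
        (∀ n, 1 ≤ n → ∀ i : ℕ, ∃ p : Set (ParamFormula L M n),
            IsNType M A n p ∧ IsArithmetical (typeCode g p) ∧
            tripleSection X n i = typeCode g p) ∧
        (∀ n, 1 ≤ n → ∀ p : Set (ParamFormula L M n),
            IsNType M A n p → IsArithmetical (typeCode g p) →
            ∃ i : ℕ, tripleSection X n i = typeCode g p)

/-- The set of elements occurring as a coordinate of a tuple in `X`. -/
def coordSet {N : Type} {n : ℕ} (X : Set (Fin n → N)) : Set N :=
  { m | ∃ v ∈ X, ∃ i, v i = m }


/-- The range of an elementary embedding, as an elementary substructure. -/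
def elementaryRange {M N : Type*} [L.Structure M] [L.Structure N] (f : M ↪ₑ[L] N) :
    L.ElementarySubstructure N where
  toSubstructure := f.toHom.range
  isElementary' n φ x := by
    have hx : ∀ i, ∃ y, f y = (x i : N) := fun i => (x i).2
    choose y hy using hx
    have h₁ : ((↑) : f.toHom.range → N) ∘ x = f ∘ y := funext fun i => (hy i).symm
    have h₂ : x = f.toEmbedding.equivRange ∘ y :=
      funext fun i => Subtype.ext ((hy i).symm.trans (f.toEmbedding.equivRange_apply (y i)).symm)
    have h₃ := StrongHomClass.realize_formula f.toEmbedding.equivRange φ (v := y)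
    rw [← h₂] at h₃
    rw [h₁, f.map_formula]
    exact h₃.symm

theorem mem_elementaryRange {M N : Type*} [L.Structure M] [L.Structure N] (f : M ↪ₑ[L] N)
    (x : N) : x ∈ ((elementaryRange f).toSubstructure : Set N) ↔ ∃ y, f y = x :=
  Iff.rfl

section Ultraproducts

open Filter

variable {α : Type*} {u : Ultrafilter α}

/-- The diagonal embedding of a structure into its ultrapower. -/
def diagonal (u : Ultrafilter α) (M : Type*) [L.Structure M] [Nonempty M] :
    M ↪ₑ[L] (u : Filter α).Product (fun _ => M) where
  toFun x := ((fun _ => x : α → M) : (u : Filter α).Product (fun _ => M))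
  map_formula' n φ x := by
    refine (Ultraproduct.realize_formula_cast φ (fun i _ => x i)).trans ?_
    exact eventually_const

theorem ultraproduct_cast_eq {M : α → Type*} {x y : ∀ a, M a} :
    (x : (u : Filter α).Product M) = (y : (u : Filter α).Product M) ↔ ∀ᶠ a in u, x a = y a :=
  Quotient.eq''

/-- The ultraproduct of a family of elementary embeddings. -/
def ultraproductMap (u : Ultrafilter α) {M N : α → Type*} [∀ a, L.Structure (M a)]
    [∀ a, L.Structure (N a)] [∀ a, Nonempty (M a)] [∀ a, Nonempty (N a)]
    (f : ∀ a, M a ↪ₑ[L] N a) : (u : Filter α).Product M ↪ₑ[L] (u : Filter α).Product N where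
  toFun := Quotient.map' (fun x a => f a (x a))
    fun _ _ h => h.mono fun a ha => congrArg (f a) ha
  map_formula' n φ x := by
    choose y hy using fun i => Quotient.exists_rep (x i)
    obtain rfl := funext hy
    refine (Ultraproduct.realize_formula_cast φ (fun i a => f a (y i a))).trans
      (Iff.trans ?_ (Ultraproduct.realize_formula_cast φ y).symm)
    exact eventually_congr (Eventually.of_forall fun a => (f a).map_formula φ fun i => y i a)

/-- The ultraproduct of proper elementary extensions is proper. -/
theorem exists_notMem_range_ultraproductMap {M N : α → Type*} [∀ a, L.Structure (M a)]
    [∀ a, L.Structure (N a)] [∀ a, Nonempty (M a)] [∀ a, Nonempty (N a)]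
    (f : ∀ a, M a ↪ₑ[L] N a) (hf : ∀ a, ∃ c, ∀ x, f a x ≠ c) :
    ∃ c, ∀ x, ultraproductMap u f x ≠ c := by
  choose c hc using hf
  refine ⟨(c : (u : Filter α).Product N), fun x => ?_⟩
  induction x using Quotient.inductionOn' with
  | h x =>
    intro h
    have h' : ∀ᶠ a in (u : Filter α), f a (x a) = c a := ultraproduct_cast_eq.1 h
    obtain ⟨a, ha⟩ := h'.exists
    exact hc a _ ha

end Ultraproducts

theorem mem_smSet_ultraproduct_cast {α : Type} {u : Ultrafilter α} {M : α → Type}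
    [∀ a, L.Structure (M a)] [∀ a, Nonempty (M a)] {k : ℕ} (φ : L.Formula (Fin 1 ⊕ Fin k))
    (p : Fin k → ∀ a, M a) (x : ∀ a, M a) :
    (x : (u : Filter α).Product M) ∈ smSet L ((u : Filter α).Product M) inferInstance φ
        (fun i => (p i : (u : Filter α).Product M)) ↔
      ∀ᶠ a in u, x a ∈ smSet L (M a) inferInstance φ (fun i => p i a) := by
  have h₁ : (Sum.elim (fun _ => (x : (u : Filter α).Product M))
      (fun i => (p i : (u : Filter α).Product M)) : Fin 1 ⊕ Fin k → _) =
      fun s => ((Sum.elim (fun _ => x) p s : ∀ a, M a) : (u : Filter α).Product M) := by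
    funext s; cases s <;> rfl
  have h₂ : ∀ a, (Sum.elim (fun _ => x a) (fun i => p i a) : Fin 1 ⊕ Fin k → M a) =
      fun s => Sum.elim (fun _ => x) p s a := by
    intro a; funext s; cases s <;> rfl
  simp only [smSet, Set.mem_ofPred_eq, h₂]
  exact (Iff.of_eq (congrArg φ.Realize h₁)).trans
    (Ultraproduct.realize_formula_cast φ (Sum.elim (fun _ => x) p))

/-- An elementary embedding restricts to an embedding of definable sets. -/
theorem apply_mem_smSet_iff {M N : Type} [L.Structure M] [L.Structure N] (f : M ↪ₑ[L] N) {k : ℕ}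
    (φ : L.Formula (Fin 1 ⊕ Fin k)) (p : Fin k → M) (x : M) :
    f x ∈ smSet L N inferInstance φ (fun i => f (p i)) ↔ x ∈ smSet L M inferInstance φ p := by
  have h : (Sum.elim (fun _ => f x) (fun i => f (p i)) : Fin 1 ⊕ Fin k → N) =
      f ∘ Sum.elim (fun _ => x) p := by
    funext s; cases s <;> rfl
  change Formula.Realize φ _ ↔ Formula.Realize φ _
  rw [h, f.map_formula]

/-- Every infinite structure has a proper elementary extension to which finite definable sets
acquire no new elements. -/
theorem exists_proper_elementaryExtension (M : Type) [L.Structure M] [Infinite M] :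
    ∃ (N : Type) (_ : L.Structure N) (f : M ↪ₑ[L] N), (∃ c, ∀ x, f x ≠ c) ∧
      ∀ (k : ℕ) (φ : L.Formula (Fin 1 ⊕ Fin k)) (p : Fin k → M),
        (smSet L M inferInstance φ p).Finite →
        ∀ y ∈ smSet L N inferInstance φ (fun i => f (p i)), ∃ x, f x = y := by
  refine ⟨(Filter.hyperfilter ℕ : Filter ℕ).Product (fun _ => M), inferInstance,
    diagonal (Filter.hyperfilter ℕ) M, ?_, ?_⟩
  · refine ⟨((Infinite.natEmbedding M : ℕ → M) : Filter.Product _ _), fun x h => ?_⟩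
    have h' : ∀ᶠ n in Filter.hyperfilter ℕ, x = Infinite.natEmbedding M n :=
      ultraproduct_cast_eq.1 h
    have hfin : {n | x = Infinite.natEmbedding M n}.Finite :=
      Set.Subsingleton.finite fun a ha b hb =>
        (Infinite.natEmbedding M).injective (Eq.trans (Eq.symm ha) hb)
    exact Filter.notMem_hyperfilter_of_finite hfin h'
  · intro k φ p hfin y hy
    induction y using Quotient.inductionOn' with
    | h y =>
      have hy' := (mem_smSet_ultraproduct_cast φ (fun i _ => p i) y).1 hy
      obtain ⟨x, -, hx⟩ := (Ultrafilter.eventually_exists_mem_iff hfin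
        (P := fun x n => x = y n)).1 (hy'.mono fun n hn => ⟨y n, hn, rfl⟩)
      exact ⟨x, ultraproduct_cast_eq.2 hx⟩

/-- In a non-principal ultraproduct over `ℕ`, definable sets of unbounded size become infinite. -/
theorem infinite_smSet_ultraproduct {M : ℕ → Type} [∀ n, L.Structure (M n)]
    [∀ n, Nonempty (M n)] {k : ℕ} (φ : L.Formula (Fin 1 ⊕ Fin k)) (p : Fin k → ∀ n, M n)
    (hp : ∀ n, n < (smSet L (M n) inferInstance φ (fun i => p i n)).ncard) :
    (smSet L ((Filter.hyperfilter ℕ : Filter ℕ).Product M) inferInstance φ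
      (fun i => (p i : Filter.Product _ _))).Infinite := by
  have he : ∀ n, ∃ e : ℕ → M n, Set.InjOn e (Set.Iic n) ∧
      ∀ j ≤ n, e j ∈ smSet L (M n) inferInstance φ (fun i => p i n) := by
    intro n
    have hfin := Set.finite_of_ncard_pos (Nat.zero_lt_of_lt (hp n))
    obtain ⟨e, hes, hinj⟩ := (Set.finite_Iic n).exists_injOn_of_encard_le
      (t := smSet L (M n) inferInstance φ (fun i => p i n)) (by
        rw [← (Set.finite_Iic n).cast_ncard_eq, ← hfin.cast_ncard_eq]
        simpa using Order.add_one_le_of_lt (Nat.cast_lt (α := ℕ∞).2 (hp n)))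
    exact ⟨e, hinj, fun j hj => hes hj⟩
  choose e hinj hmem using he
  have hlarge : ∀ j, ∀ᶠ n : ℕ in Filter.hyperfilter ℕ, j ≤ n := fun j =>
    Nat.hyperfilter_le_atTop (Filter.eventually_ge_atTop j)
  refine Set.infinite_of_injective_forall_mem
    (f := fun j => ((fun n => e n j : ∀ n, M n) : Filter.Product _ M)) ?_ ?_
  · intro i j hij
    obtain ⟨n, ⟨h, hi⟩, hj⟩ :=
      (((ultraproduct_cast_eq.1 hij).and (hlarge i)).and (hlarge j)).exists
    exact hinj n hi hj h
  · intro j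
    exact (mem_smSet_ultraproduct_cast φ p _).2 ((hlarge j).mono fun n hn => hmem n j hn)

/-- **No Vaughtian pairs eliminate `∃^∞`**: for every formula `θ(x, ȳ)` there is a uniform
finite bound on the size of the finite sets it defines in models of `T`. -/
theorem no_vaughtian_pairs_eliminate_exists_infinity
    (L : FirstOrder.Language) (T : L.Theory) (hcomp : T.IsComplete)
    (hnf : NoFiniteModels L T) (hnvp : ¬ HasVaughtianPair T)
    (m : ℕ) (θ : L.Formula (Fin 1 ⊕ Fin m)) :
    ∃ n : ℕ, ∀ (N : Type) (SN : L.Structure N), ModelsT L T N SN →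
      ∀ b : Fin m → N, (smSet L N SN θ b).Finite → (smSet L N SN θ b).ncard ≤ n := by
  by_contra! hunb
  choose N SN hN b hfin hcard using hunb
  let : ∀ n, L.Structure (N n) := SN
  have hinf : ∀ n, Infinite (N n) := fun n => hnf (N n) (SN n) (hN n)
  choose N' SN' f hproper hsmall using fun n => exists_proper_elementaryExtension (L := L) (N n)
  have hne : ∀ n, Nonempty (N' n) := fun n => ⟨f n (Classical.arbitrary _)⟩
  refine hnvp ⟨(Filter.hyperfilter ℕ : Filter ℕ).Product N', inferInstance, ?_,
    elementaryRange (ultraproductMap _ f), ?_, m, θ,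
    fun i => ((fun n => f n (b n i) : ∀ n, N' n) : Filter.Product _ _), ?_, ?_, ?_⟩
  · intro φ hφ
    exact (Ultraproduct.sentence_realize φ).2
      (Filter.Eventually.of_forall fun n => ((f n).map_sentence φ).1 (hN n φ hφ))
  · obtain ⟨c, hc⟩ := exists_notMem_range_ultraproductMap (u := Filter.hyperfilter ℕ) f hproper
    intro h
    obtain ⟨x, hx⟩ := (mem_elementaryRange _ c).1 (h ▸ Set.mem_univ c)
    exact hc x hx
  · intro i
    exact (mem_elementaryRange _ _).2 ⟨((fun n => b n i : ∀ n, N n) : Filter.Product _ _), rfl⟩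
  · intro y hy
    induction y using Quotient.inductionOn' with
    | h y =>
      have hy' := (mem_smSet_ultraproduct_cast θ (fun i n => f n (b n i)) y).1 hy
      have hx : ∀ n, ∃ x, y n ∈ smSet L (N' n) inferInstance θ (fun i => f n (b n i)) →
          f n x = y n := by
        intro n
        by_cases hn : y n ∈ smSet L (N' n) inferInstance θ (fun i => f n (b n i))
        · exact (hsmall n m θ (b n) (hfin n) _ hn).imp fun x h _ => h
        · exact ⟨Classical.arbitrary _, fun h => absurd h hn⟩
      choose x hx using hx
      exact (mem_elementaryRange _ _).2 ⟨(x : Filter.Product _ _),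
        ultraproduct_cast_eq.2 (hy'.mono fun n hn => hx n hn)⟩
  · refine infinite_smSet_ultraproduct θ (fun i n => f n (b n i)) fun n => ?_
    have himage : smSet L (N' n) inferInstance θ (fun i => f n (b n i)) =
        f n '' smSet L (N n) inferInstance θ (b n) := by
      ext y
      constructor
      · intro hy
        obtain ⟨x, rfl⟩ := hsmall n m θ (b n) (hfin n) y hy
        exact ⟨x, (apply_mem_smSet_iff (f n) θ (b n) x).1 hy, rfl⟩
      · rintro ⟨x, hx, rfl⟩
        exact (apply_mem_smSet_iff (f n) θ (b n) x).2 hx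
    rw [himage, Set.ncard_image_of_injective _ (f n).injective]
    exact hcard n

end ArMorley
end

section
/- Let T be a complete arithmetically definable theory in a countable arithmetically definable language with no finite models. Assume there exist an arithmetically decidable prime model P ⊨ T and a formula ψ(x, p̄) with parameters p̄ from P, strongly minimal over P, such that every elementary extension P ≼ N ⊨ T satisfies N = acl_N(P ∪ ψ(N, p̄)). Let D be a nonzero arithmetic degree, let M₀ ⊨ T be arithmetically decidable, and let M₀ ≼ M ⊨ T be arithmetically extendible with deg_ar(M) = D. If X ⊆ M^r is an infinite set definable in M with parameters from M₀ ∪ ā for some ā ∈ M^{<ω}, and X is not contained in acl_M(M₀ ∪ ā)^r, then deg_ar(X) = D. -/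
open FirstOrder FirstOrder.Language

namespace ArMorley

variable {L : FirstOrder.Language}

/-! ## Definable predicates -/

section DefinablePredicates

/-- The `n`-ary predicate `P` is definable in the structure `S` with parameters from `A`. -/
def Dfn (L : FirstOrder.Language) {N : Type*} (S : L.Structure N) (A : Set N) {n : ℕ}
    (P : (Fin n → N) → Prop) : Prop :=
  letI := S
  A.Definable L {v | P v}

variable {L : FirstOrder.Language} {N : Type*} {S : L.Structure N} {A B : Set N} {n m : ℕ}

namespace Dfn

theorem congr {P Q : (Fin n → N) → Prop} (h : Dfn L S A P) (e : ∀ v, Q v ↔ P v) :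
    Dfn L S A Q := by
  rwa [show Q = P from funext fun v => propext (e v)]

theorem mono {P : (Fin n → N) → Prop} (h : Dfn L S A P) (hAB : A ⊆ B) : Dfn L S B P :=
  letI := S
  Set.Definable.mono h hAB

theorem and {P Q : (Fin n → N) → Prop} (hP : Dfn L S A P) (hQ : Dfn L S A Q) :
    Dfn L S A (fun v => P v ∧ Q v) :=
  letI := S
  Set.Definable.inter hP hQ

theorem not {P : (Fin n → N) → Prop} (hP : Dfn L S A P) : Dfn L S A (fun v => ¬ P v) :=
  letI := S
  Set.Definable.compl hP

theorem or {P Q : (Fin n → N) → Prop} (hP : Dfn L S A P) (hQ : Dfn L S A Q) :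
    Dfn L S A (fun v => P v ∨ Q v) :=
  letI := S
  Set.Definable.union hP hQ

theorem imp {P Q : (Fin n → N) → Prop} (hP : Dfn L S A P) (hQ : Dfn L S A Q) :
    Dfn L S A (fun v => P v → Q v) :=
  (hP.not.or hQ).congr fun _ => imp_iff_not_or

theorem const (p : Prop) : Dfn L S A (fun _ : Fin n → N => p) := by
  let := S
  by_cases hp : p <;> simp [Dfn, hp]

theorem reindex {P : (Fin n → N) → Prop} (hP : Dfn L S A P) (f : Fin n → Fin m) :
    Dfn L S A (fun v => P (fun i => v (f i))) :=
  letI := S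
  Set.Definable.preimage_comp f hP

theorem ex {P : (Fin n → N) → N → Prop}
    (h : Dfn L S A (fun w : Fin (n + 1) → N => P (fun i => w i.succ) (w 0))) :
    Dfn L S A (fun v => ∃ x, P v x) := by
  let := S
  have := Set.Definable.image_comp h (Fin.succ : Fin n → Fin (n + 1))
  refine Dfn.congr (P := fun v => v ∈ (fun g : Fin (n + 1) → N => g ∘ Fin.succ) ''
    {w | P (fun i => w i.succ) (w 0)}) this fun v => ⟨?_, ?_⟩
  · rintro ⟨x, hx⟩
    exact ⟨Fin.cons x v, by simpa using hx, by ext i; simp⟩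
  · rintro ⟨w, hw, rfl⟩
    exact ⟨w 0, hw⟩

theorem all {P : (Fin n → N) → N → Prop}
    (h : Dfn L S A (fun w : Fin (n + 1) → N => P (fun i => w i.succ) (w 0))) :
    Dfn L S A (fun v => ∀ x, P v x) :=
  (Dfn.ex (P := fun v x => ¬ P v x) h.not).not.congr fun v => by simp

theorem eq (i j : Fin n) : Dfn L S A (fun v => v i = v j) :=
  letI := S
  ⟨(Term.var i).equal (Term.var j), by ext v; simp⟩

theorem eq_param {c : N} (hc : c ∈ A) (i : Fin n) : Dfn L S A (fun v => v i = c) :=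
  letI := S
  ⟨(Term.var i).equal (L.con (⟨c, hc⟩ : ↑A)).term, by ext v; simp⟩

theorem specialize {Q : N → (Fin n → N) → Prop} {c : N}
    (hQ : Dfn L S A (fun w : Fin (n + 1) → N => Q (w 0) (fun i => w i.succ))) (hc : c ∈ A) :
    Dfn L S A (Q c) :=
  (Dfn.ex (P := fun v x => x = c ∧ Q x v) ((Dfn.eq_param hc 0).and hQ)).congr fun v => by simp

/-- A predicate definable over `insert c A` is a fibre at `c` of one definable over `A`. -/
theorem exists_fiber {P : (Fin n → N) → Prop} {c : N} (hP : Dfn L S (insert c A) P) :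
    ∃ Q : N → (Fin n → N) → Prop,
      Dfn L S A (fun w : Fin (n + 1) → N => Q (w 0) (fun i => w i.succ)) ∧ ∀ v, P v ↔ Q c v := by
  classical
  let := S
  obtain ⟨φ, hφ⟩ := Set.definable_iff_exists_formula_sum.1 hP
  let ρ : ↑(insert c A) ⊕ Fin n → ↑A ⊕ Fin (n + 1) :=
    Sum.elim (fun x => if h : (x : N) ∈ A then Sum.inl ⟨x, h⟩ else Sum.inr 0)
      (fun i => Sum.inr i.succ)
  let Q : (Fin (n + 1) → N) → Prop := fun w =>
    (φ.relabel ρ).Realize (Sum.elim (fun x : ↑A => (x : N)) w)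
  have hQ : Dfn L S A Q := Set.definable_iff_exists_formula_sum.2 ⟨φ.relabel ρ, rfl⟩
  refine ⟨fun x v => Q (Fin.cons x v), hQ.congr fun w => ?_, fun v => ?_⟩
  · have : (Fin.cons (w 0) (fun i => w i.succ) : Fin (n + 1) → N) = w := Fin.cons_self_tail w
    simp only [this]
  · have h1 : P v ↔ φ.Realize (Sum.elim (fun x : ↑(insert c A) => (x : N)) v) :=
      Set.ext_iff.1 hφ v
    rw [h1]
    simp only [Q, Formula.realize_relabel]
    have : (Sum.elim (fun x : ↑A => (x : N)) (Fin.cons c v : Fin (n + 1) → N)) ∘ ρ =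
        Sum.elim (fun x : ↑(insert c A) => (x : N)) v := by
      funext x
      rcases x with ⟨x, hx⟩ | i
      · by_cases h : x ∈ A
        · simp [ρ, h]
        · obtain rfl : x = c := by simpa [h] using hx
          simp [ρ, h]
      · simp [ρ]
    rw [this]

end Dfn

theorem definableOverT_iff {N : Type} {S : L.Structure N} {A : Set N} {P : (Fin n → N) → Prop} :
    DefinableOverT L N S A {v | P v} ↔ Dfn L S A P := by
  let := S
  constructor
  · rintro ⟨m, ψ, b, hb, h⟩
    refine Set.definable_iff_exists_formula_sum.2
      ⟨ψ.relabel (Sum.elim Sum.inr (fun i => Sum.inl ⟨b i, hb i⟩)), ?_⟩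
    rw [h]
    ext v
    simp only [Set.mem_ofPred_eq, Formula.realize_relabel]
    have : (Sum.elim (fun x : ↑A => (x : N)) v) ∘
        (Sum.elim Sum.inr (fun i => Sum.inl ⟨b i, hb i⟩)) = Sum.elim v b := by
      funext x
      rcases x with i | i <;> rfl
    rw [this]
  · intro h
    obtain ⟨A₀, hA₀, h⟩ := Set.definable_iff_finitely_definable.1 h
    obtain ⟨φ, hφ⟩ := Set.definable_iff_exists_formula_sum.1 h
    let e := A₀.equivFin
    refine ⟨A₀.card, φ.relabel (Sum.elim (fun x => Sum.inr (e x)) Sum.inl),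
      fun i => (e.symm i : N), fun i => hA₀ (e.symm i).2, ?_⟩
    rw [hφ]
    ext v
    simp only [Set.mem_ofPred_eq, Formula.realize_relabel]
    have : (Sum.elim v (fun i => ((e.symm i : A₀) : N))) ∘
        (Sum.elim (fun x => Sum.inr (e x)) Sum.inl) =
        Sum.elim (fun x : (A₀ : Set N) => (x : N)) v := by
      funext x
      rcases x with i | i
      · simp
      · rfl
    rw [this]

end DefinablePredicates

/-! ## Algebraic closure and strongly minimal sets -/

section AlgebraicClosure

variable {L : FirstOrder.Language} {N : Type*} {S : L.Structure N} {A B : Set N} {n : ℕ}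

/-- `P` has at most `k` solutions (when the ambient type is nonempty). -/
def AtMost {N : Type*} : ℕ → (N → Prop) → Prop
  | 0, P => ∀ x, ¬ P x
  | k + 1, P => ∃ z, AtMost k (fun x => P x ∧ x ≠ z)

theorem AtMost.finite {k : ℕ} {P : N → Prop} (h : AtMost k P) : {x | P x}.Finite := by
  induction k generalizing P with
  | zero => exact Set.Finite.subset Set.finite_empty fun x hx => (h x hx).elim
  | succ k ih =>
    obtain ⟨z, hz⟩ := h
    refine ((ih hz).insert z).subset fun x hx => ?_
    by_cases hxz : x = z
    · exact Or.inl hxz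
    · exact Or.inr ⟨hx, hxz⟩

theorem AtMost.card_le {k : ℕ} {P : N → Prop} (h : AtMost k P) (t : Finset N)
    (ht : ∀ x ∈ t, P x) : t.card ≤ k := by
  classical
  induction k generalizing P t with
  | zero =>
    rw [Finset.eq_empty_of_forall_notMem fun x hx => h x (ht x hx), Finset.card_empty]
  | succ k ih =>
    obtain ⟨z, hz⟩ := h
    have := ih hz (t.erase z) fun x hx =>
      ⟨ht x (Finset.mem_of_mem_erase hx), Finset.ne_of_mem_erase hx⟩
    have := Finset.pred_card_le_card_erase (s := t) (a := z)
    omega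

theorem exists_atMost [Nonempty N] {P : N → Prop} (h : {x | P x}.Finite) :
    ∃ k, AtMost k P := by
  classical
  obtain ⟨t, ht⟩ := h.exists_finset
  induction t using Finset.induction_on generalizing P with
  | empty => exact ⟨0, fun x hx => by simpa using (ht x).2 hx⟩
  | insert a t ha ih =>
    obtain ⟨k, hk⟩ := ih (P := fun x => P x ∧ x ≠ a)
      (h.subset fun x hx => hx.1) (fun x => by
        have : x ∈ insert a t ↔ P x := ht x
        rw [Set.mem_ofPred_eq, ← this, Finset.mem_insert]
        constructor
        · intro hx
          exact ⟨Or.inr hx, fun e => ha (e ▸ hx)⟩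
        · rintro ⟨hx | hx, hne⟩
          · exact (hne hx).elim
          · exact hx)
    exact ⟨k + 1, a, hk⟩

theorem atMost_false [Nonempty N] (k : ℕ) : AtMost k fun _ : N => False := by
  induction k with
  | zero => exact fun _ h => h
  | succ k ih => exact ⟨Classical.arbitrary N, by simpa using ih⟩

theorem Dfn.atMost (k : ℕ) {P : (Fin n → N) → N → Prop}
    (h : Dfn L S A (fun w : Fin (n + 1) → N => P (fun i => w i.succ) (w 0))) :
    Dfn L S A (fun v => AtMost k (P v)) := by
  induction k generalizing n with
  | zero => exact Dfn.all (P := fun v x => ¬ P v x) h.not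
  | succ k ih =>
    refine Dfn.ex (P := fun v z => AtMost k (fun x => P v x ∧ x ≠ z)) ?_
    refine ih (P := fun w x => P (fun i => w i.succ) x ∧ x ≠ w 0) ?_
    exact (h.reindex (Fin.cons 0 fun i => i.succ.succ)).and (Dfn.eq 0 1).not

/-- Algebraic closure, in terms of definable predicates. -/
def acl (S : L.Structure N) (A : Set N) : Set N :=
  {a | ∃ F : N → Prop, {x | F x}.Finite ∧ F a ∧ Dfn L S A (fun v : Fin 1 → N => F (v 0))}

theorem aclIn_eq {N : Type} {S : L.Structure N} {A : Set N} : aclIn L N S A = acl S A := by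
  ext a
  constructor
  · rintro ⟨k, φ, b, hb, ha, hF⟩
    refine ⟨_, hF, ha, definableOverT_iff.1 ⟨k, φ, b, hb, ?_⟩⟩
    ext v
    obtain ⟨x, rfl⟩ : ∃ x, v = fun _ => x := ⟨v 0, funext fun i => by rw [Subsingleton.elim i 0]⟩
    rfl
  · rintro ⟨F, hF, ha, hD⟩
    obtain ⟨k, φ, b, hb, h⟩ := definableOverT_iff.2 hD
    have h' (x : N) : F x ↔
        @FirstOrder.Language.Formula.Realize L N S _ φ (Sum.elim (fun _ => x) b) :=
      Set.ext_iff.1 h (fun _ => x)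
    refine ⟨k, φ, b, hb, (h' a).1 ha, ?_⟩
    convert hF using 3 with x
    exact (h' x).symm

theorem acl_mono (h : A ⊆ B) : acl S A ⊆ acl S B :=
  fun _ ⟨F, hF, ha, hD⟩ => ⟨F, hF, ha, hD.mono h⟩

theorem subset_acl : A ⊆ acl S A :=
  fun a ha => ⟨fun x => x = a, by simp, rfl, Dfn.eq_param ha 0⟩

/-- An element algebraic over `insert c A` satisfies a relation to `c` definable over `A`
with a uniform bound on the size of its fibres. -/
theorem exists_uniform_of_mem_acl_insert {a c : N} (h : a ∈ acl S (insert c A)) :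
    ∃ (k : ℕ) (φ : N → N → Prop), Dfn L S A (fun v : Fin 2 → N => φ (v 0) (v 1)) ∧
      φ c a ∧ ∀ y, AtMost k (φ y) := by
  have : Nonempty N := ⟨a⟩
  obtain ⟨F, hF, ha, hD⟩ := h
  obtain ⟨Q, hQ, hFQ⟩ := hD.exists_fiber
  obtain ⟨k, hk⟩ := exists_atMost hF
  have hFQ' (x : N) : F x ↔ Q c (fun _ => x) := hFQ fun _ => x
  have hQ2 : Dfn L S A (fun v : Fin 2 → N => Q (v 0) (fun _ => v 1)) := by
    refine hQ.congr fun v => ?_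
    have : (fun _ : Fin 1 => v 1) = fun i : Fin 1 => v i.succ := by
      ext i
      rw [Subsingleton.elim i 0]
      rfl
    rw [this]
  have hb : Dfn L S A (fun v : Fin 2 → N => AtMost k fun x => Q (v 0) fun _ => x) :=
    Dfn.atMost (P := fun v x => Q (v 0) fun _ => x) k (hQ2.reindex ![1, 0])
  obtain rfl : F = fun x => Q c fun _ => x := funext fun x => propext (hFQ' x)
  refine ⟨k, fun y x => AtMost k (fun x => Q y fun _ => x) ∧ Q y fun _ => x,
    hb.and hQ2, ⟨hk, ha⟩, fun y => ?_⟩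
  by_cases hy : AtMost k (fun x => Q y fun _ => x)
  · simp [hy]
  · simpa [hy] using atMost_false k

theorem mem_acl_of_mem_acl_insert {a c : N} (hc : c ∈ acl S A) (h : a ∈ acl S (insert c A)) :
    a ∈ acl S A := by
  obtain ⟨k, φ, hφ, hca, hk⟩ := exists_uniform_of_mem_acl_insert h
  obtain ⟨F, hF, hFc, hD⟩ := hc
  refine ⟨fun x => ∃ y, F y ∧ φ y x, ?_, ⟨c, hFc, hca⟩, ?_⟩
  · refine (hF.biUnion fun y _ => (hk y).finite).subset ?_
    rintro x ⟨y, hy, hx⟩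
    exact Set.mem_biUnion (show y ∈ {x | F x} from hy) hx
  · exact Dfn.ex (P := fun v y => F y ∧ φ y (v 0)) ((hD.reindex ![0]).and hφ)

theorem exists_finset_of_mem_acl {a : N} (h : a ∈ acl S A) :
    ∃ t : Finset N, (t : Set N) ⊆ A ∧ a ∈ acl S (t : Set N) := by
  let := S
  obtain ⟨F, hF, ha, hD⟩ := h
  obtain ⟨t, ht, hD'⟩ := Set.definable_iff_finitely_definable.1 hD
  exact ⟨t, ht, F, hF, ha, hD'⟩

theorem acl_subset_of_subset (h : B ⊆ acl S A) : acl S B ⊆ acl S A := by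
  classical
  intro a ha
  obtain ⟨t, ht, hat⟩ := exists_finset_of_mem_acl ha
  replace hat : a ∈ acl S (t ∪ A) := acl_mono Set.subset_union_left hat
  replace ht := ht.trans h
  clear ha
  induction t using Finset.induction_on with
  | empty => simpa using hat
  | insert c t _ ih =>
    rw [Finset.coe_insert, Set.insert_subset_iff] at ht
    refine ih (mem_acl_of_mem_acl_insert (acl_mono Set.subset_union_right ht.1) ?_) ht.2
    rwa [Finset.coe_insert, Set.insert_union] at hat

end AlgebraicClosure

section StronglyMinimal

variable {L : FirstOrder.Language} {N : Type*} {S : L.Structure N} {A : Set N} {n : ℕ}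

/-- Every definable subset of `D` is finite or cofinite in `D`. -/
def StronglyMinimal (S : L.Structure N) (D : N → Prop) : Prop :=
  ∀ P : N → Prop, Dfn L S Set.univ (fun v : Fin 1 → N => P (v 0)) →
    {y | D y ∧ P y}.Finite ∨ {y | D y ∧ ¬ P y}.Finite

/-- A definable family indexed by points of `X`, with finite traces on `D` of bounded size,
which together cover all but finitely many points of `D`. -/
def FinitelyCovers (D X : N → Prop) (k l : ℕ) (θ : N → N → Prop) : Prop :=
  (∀ x, AtMost k fun y => D y ∧ θ x y) ∧ AtMost l fun y => D y ∧ ¬ ∃ x, X x ∧ θ x y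

variable {D X : N → Prop}

theorem StronglyMinimal.finite_compl_of_notMem_acl (hD : StronglyMinimal S D)
    (hDA : Dfn L S A (fun v : Fin 1 → N => D (v 0))) {P : N → Prop}
    (hP : Dfn L S A (fun v : Fin 1 → N => P (v 0))) {d : N} (hd : D d) (hPd : P d)
    (hda : d ∉ acl S A) : {y | D y ∧ ¬ P y}.Finite :=
  (hD P (hP.mono (Set.subset_univ A))).resolve_left fun h =>
    hda ⟨_, h, ⟨hd, hPd⟩, hDA.and hP⟩

/-- The exchange property, in the form of a finite covering of `D` indexed by `X`. -/
theorem StronglyMinimal.exists_finitelyCovers (hD : StronglyMinimal S D)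
    (hDinf : {y | D y}.Infinite) (hDA : Dfn L S A (fun v : Fin 1 → N => D (v 0)))
    (hXA : Dfn L S A (fun v : Fin 1 → N => X (v 0))) {d m : N} (hd : D d) (hm : X m)
    (hmd : m ∈ acl S (insert d A)) (hmA : m ∉ acl S A) :
    ∃ (k l : ℕ) (θ : N → N → Prop), Dfn L S A (fun v : Fin 2 → N => θ (v 0) (v 1)) ∧
      FinitelyCovers D X k l θ := by
  have : Nonempty N := ⟨m⟩
  have hdA : d ∉ acl S A := fun h => hmA (mem_acl_of_mem_acl_insert h hmd)
  obtain ⟨K, φ, hφ, hdm, hK⟩ := exists_uniform_of_mem_acl_insert hmd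
  have hφu (x : N) : Dfn L S Set.univ (fun v : Fin 1 → N => φ (v 0) x) :=
    Dfn.specialize (Q := fun x v => φ (v 0) x)
      ((hφ.mono (Set.subset_univ _)).reindex ![1, 0]) (Set.mem_univ x)
  have hfin : {y | D y ∧ φ y m}.Finite := by
    refine (hD _ (hφu m)).resolve_right fun hcof => ?_
    obtain ⟨l, hl⟩ := exists_atMost hcof
    refine hmA ⟨fun x => AtMost l fun y => D y ∧ ¬ φ y x, ?_, hl,
      Dfn.atMost (P := fun v y => D y ∧ ¬ φ y (v 0)) l ((hDA.reindex ![0]).and hφ.not)⟩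
    by_contra hinf
    obtain ⟨t, ht, htc⟩ := Set.Infinite.exists_subset_card_eq hinf (K + 1)
    have hbad : (⋃ x ∈ t, {y | D y ∧ ¬ φ y x}).Finite :=
      t.finite_toSet.biUnion fun x hx => AtMost.finite (ht hx)
    obtain ⟨y, hy, hyb⟩ := hDinf.exists_notMem_finite hbad
    have := (hK y).card_le t fun x hx => by
      by_contra hne
      exact hyb (Set.mem_biUnion (show x ∈ (t : Set N) from hx) ⟨hy, hne⟩)
    omega
  obtain ⟨k, hk⟩ := exists_atMost hfin
  let θ : N → N → Prop := fun x y => φ y x ∧ AtMost k fun y' => D y' ∧ φ y' x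
  have hθ : Dfn L S A (fun v : Fin 2 → N => θ (v 0) (v 1)) :=
    (hφ.reindex ![1, 0]).and
      (Dfn.atMost (P := fun v y' => D y' ∧ φ y' (v 0)) k
        ((hDA.reindex ![0]).and (hφ.reindex ![0, 1])))
  have hcov : {y | D y ∧ ¬ ∃ x, X x ∧ θ x y}.Finite :=
    hD.finite_compl_of_notMem_acl hDA
      (Dfn.ex (P := fun v x => X x ∧ θ x (v 0)) ((hXA.reindex ![0]).and hθ)) hd
      ⟨m, hm, hdm, hk⟩ hdA
  obtain ⟨l, hl⟩ := exists_atMost hcov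
  obtain ⟨j, hj⟩ : ∃ j, ∀ x, AtMost j fun y => D y ∧ θ x y := by
    refine ⟨k, fun x => ?_⟩
    by_cases hx : AtMost k fun y' => D y' ∧ φ y' x
    · simp [θ, hx]
    · simpa [θ, hx] using atMost_false k
  exact ⟨j, l, θ, hθ, hj, hl⟩

/-- A finite covering definable over `insert d A` can be moved to one definable over `A`. -/
theorem StronglyMinimal.finitelyCovers_descend (hD : StronglyMinimal S D)
    (hDA : Dfn L S A (fun v : Fin 1 → N => D (v 0)))
    (hXA : Dfn L S A (fun v : Fin 1 → N => X (v 0))) (hinf : {y | D y ∧ y ∈ A}.Infinite)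
    {d : N} (hd : D d) (hdA : d ∉ acl S A) {k l : ℕ}
    (h : ∃ θ : N → N → Prop, Dfn L S (insert d A) (fun v : Fin 2 → N => θ (v 0) (v 1)) ∧
      FinitelyCovers D X k l θ) :
    ∃ θ : N → N → Prop, Dfn L S A (fun v : Fin 2 → N => θ (v 0) (v 1)) ∧
      FinitelyCovers D X k l θ := by
  obtain ⟨θ, hθ, hcov⟩ := h
  obtain ⟨Q, hQ, hθQ⟩ := hθ.exists_fiber
  let Θ : N → N → N → Prop := fun z x y => Q z ![x, y]
  have hΘ : Dfn L S A (fun v : Fin 3 → N => Θ (v 0) (v 1) (v 2)) := by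
    refine hQ.congr fun v => ?_
    have : (fun i : Fin 2 => v i.succ) = ![v 1, v 2] := by
      ext i
      fin_cases i <;> rfl
    rw [this]
  obtain rfl : θ = Θ d := funext fun x => funext fun y => propext (hθQ ![x, y])
  have hG : Dfn L S A (fun v : Fin 1 → N => FinitelyCovers D X k l (Θ (v 0))) := by
    refine Dfn.and ?_ ?_
    · refine Dfn.all (P := fun v x => AtMost k fun y => D y ∧ Θ (v 0) x y) ?_
      refine Dfn.atMost (P := fun v y => D y ∧ Θ (v 1) (v 0) y) k ?_
      exact (hDA.reindex ![0]).and (hΘ.reindex ![2, 1, 0])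
    · refine Dfn.atMost (P := fun v y => D y ∧ ¬ ∃ x, X x ∧ Θ (v 0) x y) l ?_
      refine (hDA.reindex ![0]).and (Dfn.not ?_)
      refine Dfn.ex (P := fun v x => X x ∧ Θ (v 1) x (v 0)) ?_
      exact (hXA.reindex ![0]).and (hΘ.reindex ![2, 0, 1])
  have hcof := hD.finite_compl_of_notMem_acl
    (P := fun z => FinitelyCovers D X k l (Θ z)) hDA hG hd hcov hdA
  obtain ⟨z, ⟨hzD, hzA⟩, hz⟩ := hinf.exists_notMem_finite hcof
  refine ⟨Θ z, Dfn.specialize (Q := fun z v => Θ z (v 0) (v 1)) hΘ hzA, ?_⟩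
  by_contra hne
  exact hz ⟨hzD, hne⟩

/-- An infinite `A`-definable set with a point outside `acl A` that is algebraic over `A`
and a strongly minimal set `D` generates `D` algebraically. -/
theorem StronglyMinimal.subset_acl_union (hD : StronglyMinimal S D)
    (hDA : Dfn L S A (fun v : Fin 1 → N => D (v 0)))
    (hXA : Dfn L S A (fun v : Fin 1 → N => X (v 0))) (hinf : {y | D y ∧ y ∈ A}.Infinite)
    {m : N} (hm : X m) (hmA : m ∉ acl S A) (hmD : m ∈ acl S (A ∪ {y | D y})) :
    {y | D y} ⊆ acl S (A ∪ {x | X x}) := by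
  classical
  have hex : ∃ j, ∃ s : Finset N, s.card = j ∧ (∀ y ∈ s, D y) ∧ m ∈ acl S (A ∪ s) := by
    obtain ⟨t, ht, hmt⟩ := exists_finset_of_mem_acl hmD
    refine ⟨_, t.filter D, rfl, fun y hy => (Finset.mem_filter.1 hy).2, acl_mono ?_ hmt⟩
    intro y hy
    rcases ht hy with h | h
    · exact Or.inl h
    · exact Or.inr (by simpa using ⟨hy, h⟩)
  obtain ⟨s, hsc, hsD, hms⟩ := Nat.find_spec hex
  have hmin (t : Finset N) (ht : t ⊂ s) : m ∉ acl S (A ∪ t) := fun h =>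
    Nat.find_min hex (hsc ▸ Finset.card_lt_card ht)
      ⟨t, rfl, fun y hy => hsD y (ht.1 hy), h⟩
  obtain ⟨d, hd⟩ : s.Nonempty := by
    rw [Finset.nonempty_iff_ne_empty]
    rintro rfl
    exact hmA (by simpa using hms)
  have hcoe : (A ∪ (s : Set N)) = insert d (A ∪ (s.erase d : Finset N)) := by
    rw [← Set.union_insert, ← Finset.coe_insert, Finset.insert_erase hd]
  obtain ⟨k, l, hkl⟩ := hD.exists_finitelyCovers (hinf.mono fun y hy => hy.1)
    (hDA.mono Set.subset_union_left) (hXA.mono Set.subset_union_left) (hsD d hd) hm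
    (hcoe ▸ hms) (hmin _ (Finset.erase_ssubset hd))
  obtain ⟨θ, hθ, hk, hl⟩ : ∃ θ : N → N → Prop,
      Dfn L S A (fun v : Fin 2 → N => θ (v 0) (v 1)) ∧ FinitelyCovers D X k l θ := by
    have key (t : Finset N) : t ⊆ s → (∃ θ : N → N → Prop,
        Dfn L S (A ∪ (t : Set N)) (fun v : Fin 2 → N => θ (v 0) (v 1)) ∧
          FinitelyCovers D X k l θ) → ∃ θ : N → N → Prop,
        Dfn L S A (fun v : Fin 2 → N => θ (v 0) (v 1)) ∧ FinitelyCovers D X k l θ := by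
      induction t using Finset.induction_on with
      | empty => simp
      | insert e t het ih =>
        intro hts h
        have hes : e ∈ s := hts (Finset.mem_insert_self e t)
        have hts' : t ⊆ s := (Finset.subset_insert e t).trans hts
        refine ih hts' (hD.finitelyCovers_descend (hDA.mono Set.subset_union_left)
          (hXA.mono Set.subset_union_left)
          (hinf.mono fun y hy => ⟨hy.1, Or.inl hy.2⟩) (hsD e hes) ?_
          (by rwa [Finset.coe_insert, Set.union_insert] at h))
        intro he
        refine hmin _ (Finset.erase_ssubset hes) (acl_subset_of_subset ?_ hms)
        rintro y (hy | hy)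
        · exact subset_acl (Or.inl hy)
        · by_cases hye : y = e
          · subst hye
            refine acl_mono (Set.union_subset_union_right A ?_) he
            intro z hz
            simp only [Finset.coe_erase, Set.mem_sdiff, Finset.mem_coe, Set.mem_singleton_iff]
            exact ⟨hts' hz, fun hze => het (hze ▸ hz)⟩
          · exact subset_acl (Or.inr (by simpa using ⟨hy, hye⟩))
    exact key _ (Finset.erase_subset d s) (let ⟨θ, hθ⟩ := hkl; ⟨θ, hθ⟩)
  intro y hy
  by_cases hyx : ∃ x, X x ∧ θ x y
  · obtain ⟨x, hx, hxy⟩ := hyx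
    refine ⟨fun y => D y ∧ θ x y, (hk x).finite, ⟨hy, hxy⟩, ?_⟩
    have hsub : A ⊆ A ∪ {x | X x} := Set.subset_union_left
    exact (hDA.mono hsub).and (Dfn.specialize (Q := fun x v => θ x (v 0)) (hθ.mono hsub)
      (Or.inr hx))
  · refine ⟨_, hl.finite, ⟨hy, hyx⟩, (hDA.and (Dfn.not ?_)).mono Set.subset_union_left⟩
    exact Dfn.ex (P := fun v x => X x ∧ θ x (v 0)) ((hXA.reindex ![0]).and hθ)

end StronglyMinimal

/-! ## Generation of the ambient model by an infinite definable set -/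

section Generation

variable {L : FirstOrder.Language}

/-- The inclusion of an elementary substructure, as an elementary embedding. -/
def ElemSub.toEEmb {M N : CodedStructure L} (h : ElemSub M N) :
    EEmb L ↥M.carrier M.struc ↥N.carrier N.struc :=
  letI := M.struc
  letI := N.struc
  { toFun := fun x => ⟨x, h.subset x.2⟩
    map_formula' := fun k φ x => (h.elem k φ x).symm }

theorem EEmb.realize_iff {P N : Type} {SP : L.Structure P} {SN : L.Structure N}
    (j : EEmb L P SP N SN) {α : Type*} (φ : L.Formula α) (x : α → P) :
    @FirstOrder.Language.Formula.Realize L N SN _ φ (fun i => j.fn (x i)) ↔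
      @FirstOrder.Language.Formula.Realize L P SP _ φ x :=
  @ElementaryEmbedding.map_formula L P N SP SN j α φ x

theorem EEmb.fn_injective {P N : Type} {SP : L.Structure P} {SN : L.Structure N}
    (j : EEmb L P SP N SN) : Function.Injective j.fn :=
  @ElementaryEmbedding.injective L P N SP SN j

theorem EEmb.mem_smSet {P N : Type} {SP : L.Structure P} {SN : L.Structure N}
    (j : EEmb L P SP N SN) {k : ℕ} (φ : L.Formula (Fin 1 ⊕ Fin k)) (p : Fin k → P) {x : P} :
    j.fn x ∈ smSet L N SN φ (fun i => j.fn (p i)) ↔ x ∈ smSet L P SP φ p := by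
  refine Iff.trans ?_ (j.realize_iff φ (Sum.elim (fun _ => x) p))
  have : (fun i => j.fn (Sum.elim (fun _ : Fin 1 => x) p i)) =
      Sum.elim (fun _ => j.fn x) (fun i => j.fn (p i)) := by
    funext i
    rcases i with i | i <;> rfl
  rw [this]
  rfl

theorem acl_union_coordSet_eq_univ {g : GoedelCoding L} {T : L.Theory} (hctrl : SMControl g T)
    {M₀ M : CodedStructure L} (h₀ : M₀.Models T) (hM : M.Models T) (hsub : ElemSub M₀ M)
    {r : ℕ} {C : Set ↥M.carrier} (hC : {x : ↥M.carrier | (x : ℕ) ∈ M₀.carrier} ⊆ C)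
    {X : Set (Fin r → ↥M.carrier)} (hXdef : DefinableOver M C X)
    (hXna : ¬ ∀ v ∈ X, ∀ i, v i ∈ aclIn L ↥M.carrier M.struc C) :
    acl M.struc (C ∪ coordSet X) = Set.univ := by
  obtain ⟨P, -, hP, k, φ, p, ⟨hPinf, hSM⟩, hgen⟩ := hctrl
  obtain ⟨j₀⟩ := hP.2 ↥M₀.carrier M₀.struc h₀
  let j : EEmb L ↥P.carrier P.struc ↥M.carrier M.struc :=
    @ElementaryEmbedding.comp L _ _ _ P.struc M₀.struc M.struc hsub.toEEmb j₀
  have hjC (x : ↥P.carrier) : j.fn x ∈ C := hC (j₀.fn x).2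
  let q : Fin k → ↥M.carrier := fun i => j.fn (p i)
  let D : ↥M.carrier → Prop := fun x => x ∈ smSet L ↥M.carrier M.struc φ q
  have hDdef : Dfn L M.struc C (fun v : Fin 1 → ↥M.carrier => D (v 0)) := by
    refine definableOverT_iff.1 ⟨k, φ, q, fun i => hjC (p i), ?_⟩
    ext v
    obtain ⟨x, rfl⟩ : ∃ x, v = fun _ => x :=
      ⟨v 0, funext fun i => by rw [Subsingleton.elim i 0]⟩
    rfl
  have hD : StronglyMinimal M.struc D := by
    intro Q hQ
    have hdef : Dfn L M.struc Set.univ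
        (fun v : Fin 1 → ↥M.carrier => D (v 0) ∧ Q (v 0)) :=
      (hDdef.mono (Set.subset_univ C)).and hQ
    obtain ⟨m, ψ, b, -, hb⟩ := definableOverT_iff.2 hdef
    have h := hSM ↥M.carrier M.struc hM j {y | D y ∧ Q y}
      ⟨m, ψ, b, Set.ext fun x => Set.ext_iff.1 hb (fun _ => x)⟩ fun y hy => hy.1
    refine h.imp_right fun h => h.subset fun y hy => ⟨hy.1, fun h => hy.2 h.2⟩
  have hinf : {y | D y ∧ y ∈ C}.Infinite := by
    refine (hPinf.image j.fn_injective.injOn).mono ?_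
    rintro _ ⟨x, hx, rfl⟩
    exact ⟨(j.mem_smSet φ p).2 hx, hjC x⟩
  have hall (m : ↥M.carrier) : m ∈ acl M.struc (C ∪ {y | D y}) := by
    have hm : m ∈ aclIn L ↥M.carrier M.struc
        (Set.range j.fn ∪ smSet L ↥M.carrier M.struc φ q) := by
      rw [hgen ↥M.carrier M.struc hM j]
      trivial
    rw [aclIn_eq] at hm
    refine acl_mono (Set.union_subset_union_left _ ?_) hm
    rintro _ ⟨x, rfl⟩
    exact hjC x
  push Not at hXna
  obtain ⟨v, hv, i, hvi⟩ := hXna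
  rw [aclIn_eq] at hvi
  let Xi : ↥M.carrier → Prop := fun x => ∃ v ∈ X, v i = x
  have hXi : Dfn L M.struc C (fun w : Fin 1 → ↥M.carrier => Xi (w 0)) := by
    let := M.struc
    have hX : Dfn L M.struc C (fun v => v ∈ X) := definableOverT_iff.1 hXdef
    have := Set.Definable.image_comp hX (fun _ : Fin 1 => i)
    refine Dfn.congr (P := fun w => w ∈ (fun g : Fin r → ↥M.carrier => g ∘ fun _ : Fin 1 => i) ''
      {v | v ∈ X}) this fun w => ⟨?_, ?_⟩
    · rintro ⟨v, hv, h⟩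
      exact ⟨v, hv, funext fun l => by simp [h, Subsingleton.elim l 0]⟩
    · rintro ⟨v, hv, rfl⟩
      exact ⟨v, hv, rfl⟩
  have hDX : {y | D y} ⊆ acl M.struc (C ∪ {x | Xi x}) :=
    hD.subset_acl_union hDdef hXi hinf ⟨v, hv, rfl⟩ hvi (hall (v i))
  have hXiX : C ∪ {x | Xi x} ⊆ C ∪ coordSet X :=
    Set.union_subset_union_right C fun x ⟨v, hv, h⟩ => ⟨v, hv, i, h⟩
  refine Set.eq_univ_of_forall fun m => acl_subset_of_subset ?_ (hall m)
  exact Set.union_subset (Set.subset_union_left.trans subset_acl) (hDX.trans (acl_mono hXiX))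

/-- A formula with finitely many solutions in `M` has no further solutions in an elementary
extension of `M`. -/
theorem ElemSub.mem_of_finite {M N : CodedStructure L} (h : ElemSub M N) {k : ℕ}
    (φ : L.Formula (Fin (k + 1))) (b : Fin k → ↥M.carrier)
    (hfin : {x : ↥M.carrier | letI := M.struc; φ.Realize (Fin.cons x b)}.Finite)
    {x : ↥N.carrier}
    (hx : letI := N.struc; φ.Realize (Fin.cons x fun i => h.toEEmb.fn (b i))) :
    (x : ℕ) ∈ M.carrier := by
  let := M.struc
  let := N.struc
  obtain ⟨t, ht⟩ := hfin.exists_finset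
  by_contra hxM
  let e := t.equivFin
  let ψ : L.Formula (Fin k ⊕ Fin t.card) := Formula.iExs (Fin 1)
    (φ.relabel (Fin.cons (Sum.inr 0) fun i => Sum.inl (Sum.inl i)) ⊓
      Formula.iInf fun i : Fin t.card => ∼((Term.var (Sum.inr 0)).equal
        (Term.var (Sum.inl (Sum.inr i)))))
  have hψ := h.toEEmb.realize_iff ψ (Sum.elim b fun i => ((e.symm i : t) : ↥M.carrier))
  have hrel {N' : Type} (w : Fin k ⊕ Fin t.card → N') (u : Fin 1 → N') :
      (Sum.elim w u ∘ (Fin.cons (Sum.inr 0) fun i => Sum.inl (Sum.inl i) :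
        Fin (k + 1) → (Fin k ⊕ Fin t.card) ⊕ Fin 1)) = Fin.cons (u 0) fun i => w (Sum.inl i) := by
    funext i
    refine Fin.cases ?_ (fun i => ?_) i <;> simp
  simp only [ψ, Formula.realize_iExs, Formula.realize_inf, Formula.realize_relabel, hrel,
    Formula.realize_iInf, Formula.realize_not, Formula.realize_equal, Term.realize_var,
    Sum.elim_inl, Sum.elim_inr] at hψ
  obtain ⟨u, hu, hne⟩ := hψ.1 ⟨fun _ => x, hx, fun i hi => hxM (by
    have hi : x = _ := hi
    rw [hi]
    exact (e.symm i : ↥M.carrier).2)⟩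
  exact hne (e ⟨u 0, (ht _).2 hu⟩) (by simp)

end Generation

/-! ## Codes of lists, formulas and elementary diagrams -/

section Codes

variable {L : FirstOrder.Language}

theorem listCode_injective : Function.Injective listCode :=
  Encodable.encode_injective

theorem listCode_nil : listCode [] = 0 := rfl

theorem listCode_cons (a : ℕ) (l : List ℕ) :
    listCode (a :: l) = Nat.pair a (listCode l) + 1 := rfl

theorem listCode_surjective : Function.Surjective listCode := by
  intro c
  induction c using Nat.strong_induction_on with
  | _ c ih =>
    rcases c with _ | c
    · exact ⟨[], rfl⟩
    · obtain ⟨l, hl⟩ := ih c.unpair.2 (Nat.lt_succ_of_le (Nat.unpair_right_le c))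
      exact ⟨c.unpair.1 :: l, by rw [listCode_cons, hl, Nat.pair_unpair]⟩

theorem termCode_injective (g : GoedelCoding L) {α : Type} {encα : α → ℕ}
    (h : Function.Injective encα) : Function.Injective (termCode (L := L) g encα) := by
  refine listCode_injective.comp (Function.Injective.comp (List.map_injective_iff.2 ?_)
    Term.listEncode_injective)
  rintro (a | ⟨n, f⟩) (b | ⟨m, f'⟩) hab
  · simp only [Sum.elim_inl, Nat.pair_eq_pair, true_and] at hab
    rw [h hab]
  · simp [Nat.pair_eq_pair] at hab
  · simp [Nat.pair_eq_pair] at hab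
  · simp only [Sum.elim_inr, Nat.pair_eq_pair, true_and] at hab
    obtain ⟨rfl, hf⟩ := hab
    rw [g.encFun_inj n hf]

theorem formulaCode_injective (g : GoedelCoding L) {α : Type} {encα : α → ℕ}
    (h : Function.Injective encα) (n : ℕ) :
    Function.Injective (formulaCode (L := L) g encα : L.BoundedFormula α n → ℕ) := by
  have hsig : Function.Injective (BoundedFormula.listEncode : L.BoundedFormula α n → _) :=
    fun φ ψ e => by
      have := @BoundedFormula.listEncode_sigma_injective L α ⟨n, φ⟩ ⟨n, ψ⟩ e
      simpa using this
  refine listCode_injective.comp (Function.Injective.comp (List.map_injective_iff.2 ?_) hsig)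
  rintro (⟨k, t⟩ | ⟨k, R⟩ | k) (⟨k', t'⟩ | ⟨k', R'⟩ | k') e
  · simp only [Sum.elim_inl, Nat.pair_eq_pair, true_and] at e
    obtain ⟨rfl, ht⟩ := e
    have hv : Function.Injective (Sum.elim (fun a => Nat.pair 0 (encα a))
        (fun i : Fin k => Nat.pair 1 i.1)) := by
      rintro (a | i) (b | i') hab
      · simp only [Sum.elim_inl, Nat.pair_eq_pair, true_and] at hab
        rw [h hab]
      · simp [Nat.pair_eq_pair] at hab
      · simp [Nat.pair_eq_pair] at hab
      · simp only [Sum.elim_inr, Nat.pair_eq_pair, true_and] at hab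
        rw [Fin.ext hab]
    rw [termCode_injective g hv ht]
  · simp [Nat.pair_eq_pair] at e
  · simp [Nat.pair_eq_pair] at e
  · simp [Nat.pair_eq_pair] at e
  · simp only [Sum.elim_inr, Sum.elim_inl, Nat.pair_eq_pair, true_and] at e
    obtain ⟨rfl, hR⟩ := e
    rw [g.encRel_inj k hR]
  · simp [Nat.pair_eq_pair] at e
  · simp [Nat.pair_eq_pair] at e
  · simp [Nat.pair_eq_pair] at e
  · simp only [Sum.elim_inr, Nat.pair_eq_pair, true_and] at e
    rw [e]

theorem pair_listCode_mem_elemDiagram_iff (g : GoedelCoding L) (N : CodedStructure L) {k : ℕ}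
    (φ : L.Formula (Fin k)) (l : List ℕ) :
    Nat.pair (Nat.pair k (formulaCode g Fin.val φ)) (listCode l) ∈ elemDiagram g N ↔
      ∃ a : Fin k → ↥N.carrier, List.ofFn (fun i => (a i : ℕ)) = l ∧
        (letI := N.struc; φ.Realize a) := by
  constructor
  · rintro ⟨k', φ', a, h, ha⟩
    obtain ⟨h₁, h₂⟩ := Nat.pair_eq_pair.1 h
    obtain ⟨rfl, h₁⟩ := Nat.pair_eq_pair.1 h₁
    rw [formulaCode_injective g Fin.val_injective 0 h₁]
    exact ⟨a, (listCode_injective h₂).symm, ha⟩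
  · rintro ⟨a, rfl, ha⟩
    exact ⟨k, φ, a, rfl, ha⟩

end Codes

/-! ## Definable functions and arithmetical definability -/

section DefinableFunctions

variable {L : FirstOrder.Language} {N : Type*} {S : L.Structure N} {A : Set N} {n : ℕ}

/-- The function `f` has a definable graph. -/
def DFun (L : FirstOrder.Language) {N : Type*} (S : L.Structure N) (A : Set N) {n : ℕ}
    (f : (Fin n → N) → N) : Prop :=
  Dfn L S A (fun w : Fin (n + 1) → N => w 0 = f (fun i => w i.succ))

theorem DFun.proj (i : Fin n) : DFun L S A (fun v => v i) :=
  Dfn.eq 0 i.succ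

theorem DFun.lift {f : (Fin n → N) → N} (hf : DFun L S A f) :
    DFun L S A (fun w : Fin (n + 1) → N => f (fun i => w i.succ)) :=
  Dfn.reindex hf (Fin.cons 0 fun i => i.succ.succ)

theorem Dfn.subst {R : (Fin n → N) → N → Prop} {f : (Fin n → N) → N}
    (hR : Dfn L S A (fun w : Fin (n + 1) → N => R (fun i => w i.succ) (w 0)))
    (hf : DFun L S A f) : Dfn L S A (fun v => R v (f v)) :=
  (Dfn.ex (P := fun v x => x = f v ∧ R v x) (Dfn.and hf hR)).congr fun v => by simp

theorem Dfn.comp₁ {R : N → Prop} {f : (Fin n → N) → N}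
    (hR : Dfn L S A (fun v : Fin 1 → N => R (v 0))) (hf : DFun L S A f) :
    Dfn L S A (fun v => R (f v)) :=
  Dfn.subst (R := fun _ x => R x) (hR.reindex ![0]) hf

theorem Dfn.comp₂ {R : N → N → Prop} {f f' : (Fin n → N) → N}
    (hR : Dfn L S A (fun v : Fin 2 → N => R (v 0) (v 1))) (hf : DFun L S A f)
    (hf' : DFun L S A f') : Dfn L S A (fun v => R (f v) (f' v)) :=
  Dfn.subst (R := fun v x => R x (f' v))
    (Dfn.subst (R := fun w y => R (w 0) y) (hR.reindex ![1, 0]) hf'.lift) hf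

theorem Dfn.eq_fun {f f' : (Fin n → N) → N} (hf : DFun L S A f) (hf' : DFun L S A f') :
    Dfn L S A (fun v => f v = f' v) :=
  Dfn.comp₂ (R := fun x y => x = y) (Dfn.eq 0 1) hf hf'

theorem DFun.comp₂ {F : N → N → N} {f f' : (Fin n → N) → N}
    (hF : Dfn L S A (fun v : Fin 3 → N => v 0 = F (v 1) (v 2))) (hf : DFun L S A f)
    (hf' : DFun L S A f') : DFun L S A (fun v => F (f v) (f' v)) :=
  Dfn.subst (R := fun w x => w 0 = F x (f' fun i => w i.succ))
    (Dfn.subst (R := fun w y => w 1 = F (w 0) y) (hF.reindex ![2, 1, 0]) hf'.lift.lift) hf.lift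

end DefinableFunctions

section Arithmetic

/-- Predicates on `ℕ` arithmetical in the oracle `Y`. -/
abbrev AD (Y : Set ℕ) {n : ℕ} (P : (Fin n → ℕ) → Prop) : Prop :=
  Dfn arithLang (arithStructure Y) ∅ P

/-- Functions on `ℕ` arithmetical in the oracle `Y`. -/
abbrev AF (Y : Set ℕ) {n : ℕ} (f : (Fin n → ℕ) → ℕ) : Prop :=
  DFun arithLang (arithStructure Y) ∅ f

variable {Y Z : Set ℕ} {n : ℕ}

theorem AD_iff {P : (Fin n → ℕ) → Prop} : AD Y P ↔
    ∃ φ : arithLang.Formula (Fin n), ∀ v, (letI := arithStructure Y; φ.Realize v) ↔ P v := by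
  let := arithStructure Y
  refine Set.empty_definable_iff.trans (exists_congr fun φ => ?_)
  exact Set.ext_iff.trans (forall_congr' fun v => Iff.comm)

theorem arReducible_iff {X : Set ℕ} : ArReducible X Y ↔ AD Y (fun v : Fin 1 → ℕ => v 0 ∈ X) := by
  rw [AD_iff]
  refine exists_congr fun φ => ?_
  constructor
  · intro h v
    obtain ⟨x, rfl⟩ : ∃ x, v = fun _ => x :=
      ⟨v 0, funext fun i => by rw [Subsingleton.elim i 0]⟩
    exact (Set.ext_iff.1 h x).symm
  · intro h
    ext x
    exact (h fun _ => x).symm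

theorem term_realize_arithStructure {α : Type*} (t : arithLang.Term α) (v : α → ℕ) :
    @Term.realize arithLang ℕ (arithStructure Y) α v t =
      @Term.realize arithLang ℕ (arithStructure Z) α v t := by
  induction t with
  | var => rfl
  | func f ts ih =>
    have : (fun i => @Term.realize arithLang ℕ (arithStructure Y) α v (ts i)) =
      fun i => @Term.realize arithLang ℕ (arithStructure Z) α v (ts i) := funext ih
    exact congrArg (@Structure.funMap arithLang ℕ (arithStructure Y) _ f) this

theorem ArReducible.exists_formula (h : ArReducible Y Z) {α : Type*} {n : ℕ}
    (φ : arithLang.BoundedFormula α n) : ∃ ψ : arithLang.BoundedFormula α n, ∀ v xs,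
      @BoundedFormula.Realize arithLang ℕ (arithStructure Z) α n ψ v xs ↔
        @BoundedFormula.Realize arithLang ℕ (arithStructure Y) α n φ v xs := by
  induction φ with
  | falsum => exact ⟨.falsum, fun _ _ => Iff.rfl⟩
  | equal t₁ t₂ =>
    refine ⟨.equal t₁ t₂, fun v xs => ?_⟩
    unfold BoundedFormula.Realize
    rw [term_realize_arithStructure (Y := Z) (Z := Y) t₁,
      term_realize_arithStructure (Y := Z) (Z := Y) t₂]
  | @rel n k R ts =>
    rcases R with _ | _
    · refine ⟨.rel ArRel.lt ts, fun v xs => ?_⟩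
      unfold BoundedFormula.Realize
      simp only [term_realize_arithStructure (Y := Z) (Z := Y)]
      rfl
    · obtain ⟨χ, hχ⟩ := h
      let χ' : arithLang.Formula (α ⊕ Fin n) := BoundedFormula.subst χ (fun _ => ts 0)
      refine ⟨BoundedFormula.relabel (id : α ⊕ Fin n → α ⊕ Fin n) χ', fun v xs => ?_⟩
      let := arithStructure Z
      rw [BoundedFormula.realize_relabel]
      simp only [χ', BoundedFormula.realize_subst]
      have h₁ : _ ↔ χ.Realize _ := Set.ext_iff.1 hχ ((ts 0).realize (Sum.elim v xs))
      rw [Formula.Realize] at h₁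
      convert h₁.symm using 2
      · rfl
      · unfold BoundedFormula.Realize
        rw [term_realize_arithStructure (Y := Z) (Z := Y)]
        rfl
  | imp _ _ ih₁ ih₂ =>
    obtain ⟨ψ₁, h₁⟩ := ih₁
    obtain ⟨ψ₂, h₂⟩ := ih₂
    exact ⟨ψ₁.imp ψ₂, fun v xs => imp_congr (h₁ v xs) (h₂ v xs)⟩
  | all _ ih =>
    obtain ⟨ψ, h⟩ := ih
    exact ⟨ψ.all, fun v xs => forall_congr' fun x => h v _⟩

theorem AD.trans {P : (Fin n → ℕ) → Prop} (hP : AD Y P) (h : ArReducible Y Z) : AD Z P := by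
  obtain ⟨φ, hφ⟩ := AD_iff.1 hP
  obtain ⟨ψ, hψ⟩ := h.exists_formula φ
  exact AD_iff.2 ⟨ψ, fun v => (hψ v _).trans (hφ v)⟩

theorem ArReducible.trans {X : Set ℕ} (h : ArReducible X Y) (h' : ArReducible Y Z) :
    ArReducible X Z :=
  arReducible_iff.2 ((arReducible_iff.1 h).trans h')

theorem arReducible_empty : ArReducible ∅ Y :=
  arReducible_iff.2 (Dfn.const False)

theorem IsArithmetical.arReducible {X : Set ℕ} (h : IsArithmetical X) : ArReducible X Y :=
  h.trans arReducible_empty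

theorem AD.relMap₁ (R : arithLang.Relations 1) :
    AD Y (fun v : Fin 1 → ℕ => @Structure.RelMap arithLang ℕ (arithStructure Y) 1 R ![v 0]) :=
  AD_iff.2 ⟨R.formula₁ (Term.var 0), fun _ => by
    let := arithStructure Y
    exact Formula.realize_rel₁⟩

theorem AD.relMap₂ (R : arithLang.Relations 2) : AD Y (fun v : Fin 2 → ℕ =>
    @Structure.RelMap arithLang ℕ (arithStructure Y) 2 R ![v 0, v 1]) :=
  AD_iff.2 ⟨R.formula₂ (Term.var 0) (Term.var 1), fun _ => by
    let := arithStructure Y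
    exact Formula.realize_rel₂⟩

theorem AF.funMap₂ (F : arithLang.Functions 2) : AD Y (fun v : Fin 3 → ℕ =>
    v 0 = @Structure.funMap arithLang ℕ (arithStructure Y) 2 F ![v 1, v 2]) :=
  AD_iff.2 ⟨(Term.var 0).equal (F.apply₂ (Term.var 1) (Term.var 2)), fun _ => by
    let := arithStructure Y
    rw [Formula.realize_equal, Term.realize_functions_apply₂]
    rfl⟩

theorem AF.funMap₀ (c : arithLang.Functions 0) : AF Y (fun _ : Fin n → ℕ =>
    @Structure.funMap arithLang ℕ (arithStructure Y) 0 c default) :=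
  AD_iff.2 ⟨(Term.var 0).equal (Constants.term c), fun _ => by
    let := arithStructure Y
    rw [Formula.realize_equal, Term.realize_constants]
    exact Eq.congr_right (congrArg (Structure.funMap c) (Subsingleton.elim _ _))⟩

theorem AD.mem : AD Y (fun v : Fin 1 → ℕ => v 0 ∈ Y) :=
  AD.relMap₁ ArRel.mem

theorem AD.lt {f f' : (Fin n → ℕ) → ℕ} (hf : AF Y f) (hf' : AF Y f') :
    AD Y (fun v => f v < f' v) :=
  Dfn.comp₂ (R := fun x y => x < y) (AD.relMap₂ ArRel.lt) hf hf'

theorem AF.add {f f' : (Fin n → ℕ) → ℕ} (hf : AF Y f) (hf' : AF Y f') :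
    AF Y (fun v => f v + f' v) :=
  DFun.comp₂ (F := fun x y => x + y) (AF.funMap₂ ArFunc.add) hf hf'

theorem AF.mul {f f' : (Fin n → ℕ) → ℕ} (hf : AF Y f) (hf' : AF Y f') :
    AF Y (fun v => f v * f' v) :=
  DFun.comp₂ (F := fun x y => x * y) (AF.funMap₂ ArFunc.mul) hf hf'

theorem AF.const (c : ℕ) : AF Y (fun _ : Fin n → ℕ => c) := by
  induction c with
  | zero => exact AF.funMap₀ ArFunc.zero
  | succ c ih => exact AF.add ih (AF.funMap₀ ArFunc.one)

theorem AF.mod {f f' : (Fin n → ℕ) → ℕ} (hf : AF Y f) (hf' : AF Y f') :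
    AF Y (fun v => f v % f' v) := by
  refine DFun.comp₂ (F := fun x y => x % y) (Dfn.congr (P := fun v : Fin 3 → ℕ =>
    (v 2 = 0 ∧ v 0 = v 1) ∨ (v 0 < v 2 ∧ ∃ q, v 1 = q * v 2 + v 0)) ?_ fun v => ?_) hf hf'
  · refine ((Dfn.eq_fun (.proj 2) (AF.const 0)).and (Dfn.eq 0 1)).or
      ((AD.lt (.proj 0) (.proj 2)).and ?_)
    exact Dfn.ex (P := fun v q => v 1 = q * v 2 + v 0)
      (Dfn.eq_fun (.proj 2) (AF.add (AF.mul (.proj 0) (.proj 3)) (.proj 1)))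
  · constructor
    · intro h
      rcases Nat.eq_zero_or_pos (v 2) with h0 | h0
      · exact Or.inl ⟨h0, by simpa [h0] using h⟩
      · refine Or.inr ⟨h ▸ Nat.mod_lt _ h0, v 1 / v 2, ?_⟩
        rw [h, mul_comm]
        exact (Nat.div_add_mod _ _).symm
    · rintro (⟨h0, h⟩ | ⟨h, q, hq⟩)
      · simpa [h0] using h
      · rw [hq, mul_comm, Nat.mul_add_mod, Nat.mod_eq_of_lt h]

theorem AF.pair {f f' : (Fin n → ℕ) → ℕ} (hf : AF Y f) (hf' : AF Y f') :
    AF Y (fun v => Nat.pair (f v) (f' v)) := by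
  refine DFun.comp₂ (Dfn.congr (P := fun v : Fin 3 → ℕ =>
    (v 1 < v 2 ∧ v 0 = v 2 * v 2 + v 1) ∨
      (¬ v 1 < v 2 ∧ v 0 = v 1 * v 1 + v 1 + v 2)) ?_ fun v => ?_) hf hf'
  · have hlt : AD Y (fun v : Fin 3 → ℕ => v 1 < v 2) := AD.lt (.proj 1) (.proj 2)
    exact (hlt.and (Dfn.eq_fun (.proj 0) (AF.add (AF.mul (.proj 2) (.proj 2)) (.proj 1)))).or
      (hlt.not.and (Dfn.eq_fun (.proj 0)
        (AF.add (AF.add (AF.mul (.proj 1) (.proj 1)) (.proj 1)) (.proj 2))))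
  · unfold Nat.pair
    split_ifs with h <;> simp [h]

/-- An arithmetical definition of membership in a coded list: `β`-coding of its tails. -/
def MemCode (x c : ℕ) : Prop :=
  ∃ a b k t, a % (b + 1) = c ∧
    (∀ i, i < k → ∃ h, a % ((i + 1) * b + 1) =
      Nat.pair h (a % ((i + 1 + 1) * b + 1)) + 1) ∧
    a % ((k + 1) * b + 1) = Nat.pair x t + 1

theorem memCode_listCode {x : ℕ} {l : List ℕ} : MemCode x (listCode l) ↔ x ∈ l := by
  constructor
  · rintro ⟨a, b, k, t, h0, hs, hk⟩
    have key (j : ℕ) (hj : j ≤ k) : ∃ l', l' <:+ l ∧ a % ((j + 1) * b + 1) = listCode l' := by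
      induction j with
      | zero => exact ⟨l, List.suffix_rfl, by simpa using h0⟩
      | succ j ih =>
        obtain ⟨l', hl', e⟩ := ih (by omega)
        obtain ⟨h, hh⟩ := hs j (by omega)
        rw [e] at hh
        rcases l' with _ | ⟨y, l'⟩
        · simp [listCode_nil] at hh
        · rw [listCode_cons, Nat.add_right_cancel_iff, Nat.pair_eq_pair] at hh
          exact ⟨l', (List.suffix_cons y l').trans hl', hh.2.symm⟩
    obtain ⟨l', hl', e⟩ := key k le_rfl
    rw [hk] at e
    rcases l' with _ | ⟨y, l'⟩
    · simp [listCode_nil] at e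
    · rw [listCode_cons, Nat.add_right_cancel_iff, Nat.pair_eq_pair] at e
      exact hl'.subset (by simp [e.1])
  · intro hx
    obtain ⟨k, hk, rfl⟩ := List.mem_iff_getElem.1 hx
    let s := (List.range (l.length + 1)).map fun i => listCode (l.drop i)
    have hb (i : ℕ) (hi : i ≤ l.length) :
        (Nat.unbeta s).unpair.1 % ((i + 1) * (Nat.unbeta s).unpair.2 + 1) =
          listCode (l.drop i) := by
      have := Nat.beta_unbeta_coe s ⟨i, by simp [s]; omega⟩
      simpa [s, Nat.beta] using this
    refine ⟨(Nat.unbeta s).unpair.1, (Nat.unbeta s).unpair.2, k, listCode (l.drop (k + 1)),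
      by simpa using hb 0 (by omega), fun i hi => ⟨l[i], ?_⟩, ?_⟩
    · rw [hb i (by omega), hb (i + 1) (by omega), ← listCode_cons,
        List.getElem_cons_drop]
    · rw [hb k (by omega), ← listCode_cons, List.getElem_cons_drop]

theorem AD.memCode {f f' : (Fin n → ℕ) → ℕ} (hf : AF Y f) (hf' : AF Y f') :
    AD Y (fun v => MemCode (f v) (f' v)) := by
  refine Dfn.comp₂ (R := MemCode) ?_ hf hf'
  have hmod {m : ℕ} (i a b : Fin m) :
      AF Y (fun v : Fin m → ℕ => v a % ((v i + 1) * v b + 1)) :=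
    AF.mod (.proj a) (AF.add (AF.mul (AF.add (.proj i) (AF.const 1)) (.proj b)) (AF.const 1))
  have hmod' {m : ℕ} (i a b : Fin m) :
      AF Y (fun v : Fin m → ℕ => v a % ((v i + 1 + 1) * v b + 1)) :=
    AF.mod (.proj a) (AF.add (AF.mul (AF.add (AF.add (.proj i) (AF.const 1)) (AF.const 1))
      (.proj b)) (AF.const 1))
  refine Dfn.ex (P := fun v a => ∃ b k t, a % (b + 1) = v 1 ∧
    (∀ i, i < k → ∃ h, a % ((i + 1) * b + 1) =
      Nat.pair h (a % ((i + 1 + 1) * b + 1)) + 1) ∧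
    a % ((k + 1) * b + 1) = Nat.pair (v 0) t + 1) ?_
  refine Dfn.ex (P := fun v b => ∃ k t, v 0 % (b + 1) = v 2 ∧
    (∀ i, i < k → ∃ h, v 0 % ((i + 1) * b + 1) =
      Nat.pair h (v 0 % ((i + 1 + 1) * b + 1)) + 1) ∧
    v 0 % ((k + 1) * b + 1) = Nat.pair (v 1) t + 1) ?_
  refine Dfn.ex (P := fun v k => ∃ t, v 1 % (v 0 + 1) = v 3 ∧
    (∀ i, i < k → ∃ h, v 1 % ((i + 1) * v 0 + 1) =
      Nat.pair h (v 1 % ((i + 1 + 1) * v 0 + 1)) + 1) ∧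
    v 1 % ((k + 1) * v 0 + 1) = Nat.pair (v 2) t + 1) ?_
  refine Dfn.ex (P := fun v t => v 2 % (v 1 + 1) = v 4 ∧
    (∀ i, i < v 0 → ∃ h, v 2 % ((i + 1) * v 1 + 1) =
      Nat.pair h (v 2 % ((i + 1 + 1) * v 1 + 1)) + 1) ∧
    v 2 % ((v 0 + 1) * v 1 + 1) = Nat.pair (v 3) t + 1) ?_
  refine Dfn.and ?_ (Dfn.and ?_ ?_)
  · exact Dfn.eq_fun (AF.mod (.proj 3) (AF.add (.proj 2) (AF.const 1))) (.proj 5)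
  · refine Dfn.all (P := fun v i => i < v 1 → ∃ h, v 3 % ((i + 1) * v 2 + 1) =
      Nat.pair h (v 3 % ((i + 1 + 1) * v 2 + 1)) + 1) ?_
    refine Dfn.imp (AD.lt (.proj 0) (.proj 2)) ?_
    refine Dfn.ex (P := fun v h => v 4 % ((v 0 + 1) * v 3 + 1) =
      Nat.pair h (v 4 % ((v 0 + 1 + 1) * v 3 + 1)) + 1) ?_
    exact Dfn.eq_fun (hmod 1 5 4) (AF.add (AF.pair (.proj 0) (hmod' 1 5 4)) (AF.const 1))
  · exact Dfn.eq_fun (hmod 1 3 2) (AF.add (AF.pair (.proj 4) (.proj 0)) (AF.const 1))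

end Arithmetic

/-! ## Degrees of definable sets -/

section Degrees

variable {L : FirstOrder.Language} {g : GoedelCoding L} {M N : CodedStructure L} {Y : Set ℕ}

theorem ArReducible.comp_mem {X : Set ℕ} (h : ArReducible X Y) {n : ℕ} {f : (Fin n → ℕ) → ℕ}
    (hf : AF Y f) : AD Y (fun v => f v ∈ X) :=
  Dfn.comp₁ (R := fun x => x ∈ X) (arReducible_iff.1 h) hf

theorem ArReducible.union {X X' : Set ℕ} (h : ArReducible X Y) (h' : ArReducible X' Y) :
    ArReducible (X ∪ X') Y :=
  arReducible_iff.2 (Dfn.or (arReducible_iff.1 h) (arReducible_iff.1 h'))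

theorem ArithDecidable.isArithmetical_carrier (h : ArithDecidable g M) :
    IsArithmetical M.carrier := by
  refine arReducible_iff.2 (Dfn.congr (P := fun v =>
    Nat.pair (Nat.pair 1 (formulaCode g Fin.val (⊤ : L.Formula (Fin 1))))
      (Nat.pair (v 0) (listCode []) + 1) ∈ elemDiagram g M) (h.comp_mem (AF.pair (AF.const _)
        (AF.add (AF.pair (.proj 0) (AF.const _)) (AF.const 1)))) fun v => ?_)
  rw [← listCode_cons, pair_listCode_mem_elemDiagram_iff]
  constructor
  · exact fun hv => ⟨fun _ => ⟨v 0, hv⟩, by simp, fun h => h⟩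
  · rintro ⟨a, ha, -⟩
    simp only [List.ofFn_succ, List.cons.injEq] at ha
    exact ha.1 ▸ (a 0).2

/-- The code of `bs ++ l` as a function of the code of `l`. -/
def appendCode (bs : List ℕ) (c : ℕ) : ℕ :=
  bs.foldr (fun x c => Nat.pair x c + 1) c

theorem appendCode_listCode (bs l : List ℕ) :
    appendCode bs (listCode l) = listCode (bs ++ l) := by
  induction bs with
  | nil => rfl
  | cons x bs ih => rw [List.cons_append, listCode_cons, ← ih]; rfl

theorem AF.appendCode (bs : List ℕ) {n : ℕ} {f : (Fin n → ℕ) → ℕ} (hf : AF Y f) :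
    AF Y (fun v => ArMorley.appendCode bs (f v)) := by
  induction bs with
  | nil => exact hf
  | cons x bs ih => exact AF.add (AF.pair (AF.const x) ih) (AF.const 1)

theorem DefinableOver.arReducible_tupleSetCode (h : ElemSub M N) (hN : ArithDecidable g N)
    {r : ℕ} {C : Set ↥M.carrier} {X : Set (Fin r → ↥M.carrier)} (hX : DefinableOver M C X) :
    ArReducible (tupleSetCode X) M.carrier := by
  let := M.struc
  obtain ⟨m, ψ, b, -, rfl⟩ := hX
  let φ : L.Formula (Fin (m + r)) := ψ.relabel (Sum.elim (Fin.natAdd m) (Fin.castAdd r))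
  have hφ (v : Fin r → ↥M.carrier) : φ.Realize (Fin.append b v) ↔ ψ.Realize (Sum.elim v b) := by
    rw [Formula.realize_relabel]
    congr! 1
    funext i
    rcases i with i | i <;> simp
  have hofFn (v : Fin r → ↥M.carrier) : List.ofFn (fun i => ((Fin.append b v i : ↥M.carrier) : ℕ)) =
      List.ofFn (fun i => (b i : ℕ)) ++ List.ofFn (fun i => (v i : ℕ)) := by
    rw [← List.ofFn_fin_append]
    congr 1
    funext i
    refine Fin.addCases (fun i => ?_) (fun i => ?_) i <;> simp
  refine arReducible_iff.2 (Dfn.congr (P := fun v => (∀ x, MemCode x (v 0) → x ∈ M.carrier) ∧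
    Nat.pair (Nat.pair (m + r) (formulaCode g Fin.val φ))
      (appendCode (List.ofFn fun i => (b i : ℕ)) (v 0)) ∈ elemDiagram g N) ?_ fun w => ?_)
  · refine Dfn.and (Dfn.all (P := fun v x => MemCode x (v 0) → x ∈ M.carrier)
      (Dfn.imp (AD.memCode (.proj 0) (.proj 1)) (AD.mem.reindex ![0]))) ?_
    exact (IsArithmetical.arReducible hN).comp_mem
      (AF.pair (AF.const _) (AF.appendCode _ (.proj 0)))
  · obtain ⟨l, hl⟩ := listCode_surjective (w 0)
    simp only [← hl, appendCode_listCode, pair_listCode_mem_elemDiagram_iff, memCode_listCode]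
    constructor
    · rintro ⟨v, hv, hlv⟩
      obtain rfl := listCode_injective hlv
      refine ⟨fun x hx => ?_, fun i => h.toEEmb.fn (Fin.append b v i), hofFn v,
        (h.toEEmb.realize_iff φ _).2 ((hφ v).2 hv)⟩
      obtain ⟨i, rfl⟩ := List.mem_ofFn.1 hx
      exact (v i).2
    · rintro ⟨hlM, a, hal, ha⟩
      have haM (i) : (a i : ℕ) ∈ M.carrier := by
        have : (a i : ℕ) ∈ List.ofFn fun i => (a i : ℕ) := List.mem_ofFn.2 ⟨i, rfl⟩
        rw [hal, List.mem_append, List.mem_ofFn] at this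
        rcases this with ⟨j, hj⟩ | h'
        · exact hj ▸ (b j).2
        · exact hlM _ h'
      let a' : Fin (m + r) → ↥M.carrier := fun i => ⟨a i, haM i⟩
      let v : Fin r → ↥M.carrier := fun i => a' (Fin.natAdd m i)
      have hsplit : List.ofFn (fun i => (a' (Fin.castAdd r i) : ℕ)) ++
          List.ofFn (fun i => (v i : ℕ)) = List.ofFn (fun i => (b i : ℕ)) ++ l := by
        rw [← hal, ← List.ofFn_fin_append]
        congr 1
        funext i
        refine Fin.addCases (fun i => ?_) (fun i => ?_) i <;> simp [v, a']
      obtain ⟨hb, hv⟩ := List.append_inj hsplit (by simp)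
      have hb (i) : a' (Fin.castAdd r i) = b i := Subtype.ext (congrFun (List.ofFn_injective hb) i)
      have hav : a' = Fin.append b v := by
        funext i
        refine Fin.addCases (fun i => ?_) (fun i => ?_) i <;> simp [hb, v]
      refine ⟨v, (hφ v).1 ?_, by rw [← hv]; rfl⟩
      rw [← hav]
      exact (h.toEEmb.realize_iff φ a').1 ha

theorem arReducible_carrier_of_acl_eq_univ (h : ElemSub M N) (hN : ArithDecidable g N)
    {C : Set ↥M.carrier} (hacl : acl M.struc C = Set.univ) (hC : ArReducible (subCode C) Y) :
    ArReducible M.carrier Y := by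
  let := M.struc
  let := N.struc
  have hdiag {n : ℕ} {f : (Fin n → ℕ) → ℕ} (hf : AF Y f) :
      AD Y (fun v => f v ∈ elemDiagram g N) :=
    (IsArithmetical.arReducible hN).comp_mem hf
  refine arReducible_iff.2 (Dfn.congr (P := fun v => ∃ e c,
    (∀ x, MemCode x c → x ∈ subCode C) ∧
    Nat.pair e (Nat.pair (v 0) c + 1) ∈ elemDiagram g N ∧
    ∃ B, ∀ x, Nat.pair e (Nat.pair x c + 1) ∈ elemDiagram g N → x < B) ?_ fun w => ?_)
  · refine Dfn.ex (P := fun v e => ∃ c, (∀ x, MemCode x c → x ∈ subCode C) ∧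
      Nat.pair e (Nat.pair (v 0) c + 1) ∈ elemDiagram g N ∧
      ∃ B, ∀ x, Nat.pair e (Nat.pair x c + 1) ∈ elemDiagram g N → x < B) ?_
    refine Dfn.ex (P := fun v c => (∀ x, MemCode x c → x ∈ subCode C) ∧
      Nat.pair (v 0) (Nat.pair (v 1) c + 1) ∈ elemDiagram g N ∧
      ∃ B, ∀ x, Nat.pair (v 0) (Nat.pair x c + 1) ∈ elemDiagram g N → x < B) ?_
    have hp {n : ℕ} (i j k : Fin n) :
        AF Y (fun v : Fin n → ℕ => Nat.pair (v i) (Nat.pair (v j) (v k) + 1)) :=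
      AF.pair (.proj i) (AF.add (AF.pair (.proj j) (.proj k)) (AF.const 1))
    refine Dfn.and ?_ (Dfn.and (hdiag (hp 1 2 0)) ?_)
    · exact Dfn.all (P := fun v x => MemCode x (v 0) → x ∈ subCode C)
        (Dfn.imp (AD.memCode (.proj 0) (.proj 1)) (hC.comp_mem (.proj 0)))
    · refine Dfn.ex (P := fun v B => ∀ x, Nat.pair (v 1) (Nat.pair x (v 0) + 1) ∈
        elemDiagram g N → x < B) ?_
      exact Dfn.all (P := fun v x => Nat.pair (v 2) (Nat.pair x (v 1) + 1) ∈
        elemDiagram g N → x < v 0) (Dfn.imp (hdiag (hp 3 0 2)) (AD.lt (.proj 0) (.proj 1)))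
  · have hcons {k : ℕ} (x : ↥N.carrier) (b : Fin k → ↥N.carrier) :
        List.ofFn (fun i => ((Fin.cons x b : Fin (k + 1) → ↥N.carrier) i : ℕ)) =
          (x : ℕ) :: List.ofFn (fun i => (b i : ℕ)) := by
      simp [List.ofFn_succ]
    constructor
    · intro hw
      have hmem : (⟨w 0, hw⟩ : ↥M.carrier) ∈ aclIn L ↥M.carrier M.struc C := by
        rw [aclIn_eq, hacl]
        trivial
      obtain ⟨k, φ, b, hb, hφ, hfin⟩ := hmem
      let χ : L.Formula (Fin (k + 1)) := φ.relabel (Sum.elim (fun _ => 0) Fin.succ)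
      have hχ (x : ↥M.carrier) :
          χ.Realize (Fin.cons x b) ↔ φ.Realize (Sum.elim (fun _ => x) b) := by
        rw [Formula.realize_relabel]
        congr! 1
        funext i
        rcases i with i | i <;> simp
      have hemb (x : ↥M.carrier) :
          χ.Realize (Fin.cons (h.toEEmb.fn x) fun i => h.toEEmb.fn (b i) : _ → ↥N.carrier) ↔
            φ.Realize (Sum.elim (fun _ => x) b) := by
        rw [← hχ, ← h.toEEmb.realize_iff χ]
        congr! 1
        funext i
        refine Fin.cases ?_ (fun i => ?_) i <;> simp
      have hfinM : {x : ↥M.carrier | χ.Realize (Fin.cons x b)}.Finite := by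
        simpa only [hχ] using hfin
      obtain ⟨B, hB⟩ := (hfin.image Subtype.val).bddAbove
      refine ⟨Nat.pair (k + 1) (formulaCode g Fin.val χ), listCode (List.ofFn fun i => (b i : ℕ)),
        fun x hx => ?_, ?_, B + 1, fun x hx => ?_⟩
      · obtain ⟨i, rfl⟩ := List.mem_ofFn.1 (memCode_listCode.1 hx)
        exact ⟨b i, hb i, rfl⟩
      · rw [← listCode_cons, pair_listCode_mem_elemDiagram_iff]
        exact ⟨Fin.cons (h.toEEmb.fn ⟨w 0, hw⟩) fun i => h.toEEmb.fn (b i), hcons _ _,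
          (hemb _).2 hφ⟩
      · rw [← listCode_cons, pair_listCode_mem_elemDiagram_iff] at hx
        obtain ⟨a, ha, haφ⟩ := hx
        rw [← Fin.cons_self_tail a, hcons, List.cons.injEq] at ha
        have htail : Fin.tail a = fun i => h.toEEmb.fn (b i) :=
          funext fun i => Subtype.ext (congrFun (List.ofFn_injective ha.2) i)
        rw [← Fin.cons_self_tail a, htail] at haφ
        have hM := h.mem_of_finite χ b hfinM haφ
        have := hB ⟨⟨a 0, hM⟩, (hemb ⟨a 0, hM⟩).1 haφ, ha.1⟩
        omega
    · rintro ⟨e, c, hc, he, B, hB⟩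
      obtain ⟨l, rfl⟩ := listCode_surjective c
      simp only [← listCode_cons] at he hB
      obtain ⟨k', φ, a, hcode, ha⟩ := he
      obtain ⟨rfl, hl⟩ := Nat.pair_eq_pair.1 hcode
      replace hl := listCode_injective hl
      obtain ⟨k, rfl⟩ : ∃ k, k' = k + 1 :=
        Nat.exists_eq_succ_of_ne_zero fun h0 => by subst h0; simp at hl
      rw [← Fin.cons_self_tail a, hcons, List.cons.injEq] at hl
      obtain ⟨hw, rfl⟩ := hl
      have htail (i) : (Fin.tail a i : ℕ) ∈ M.carrier := by
        obtain ⟨x, -, hx⟩ := hc _ (memCode_listCode.2 (List.mem_ofFn.2 ⟨i, rfl⟩))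
        exact hx ▸ x.2
      rw [hw]
      refine h.mem_of_finite φ (fun i => ⟨Fin.tail a i, htail i⟩) ?_ (x := a 0) ?_
      · refine Set.Finite.of_finite_image (f := Subtype.val) ?_ Subtype.val_injective.injOn
        refine (Set.finite_Iio B).subset ?_
        rintro _ ⟨x, hx, rfl⟩
        refine hB x ((pair_listCode_mem_elemDiagram_iff g N φ _).2
          ⟨Fin.cons (h.toEEmb.fn x) (Fin.tail a), hcons _ _, ?_⟩)
        refine Iff.mp ?_ ((h.toEEmb.realize_iff φ _).2 hx)
        congr! 1
        funext i
        refine Fin.cases ?_ (fun i => ?_) i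
        · simp
        · rfl
      · rw [← Fin.cons_self_tail a] at ha
        exact ha

theorem arReducible_subCode_union_coordSet {s r : ℕ} {M₀ : CodedStructure L}
    (h₀ : ArithDecidable g M₀) (hsub : M₀.carrier ⊆ M.carrier) (a : Fin s → ↥M.carrier)
    (X : Set (Fin r → ↥M.carrier)) :
    ArReducible (subCode ({x : ↥M.carrier | (x : ℕ) ∈ M₀.carrier} ∪ Set.range a ∪ coordSet X))
      (tupleSetCode X) := by
  unfold subCode
  rw [Set.image_union, Set.image_union]
  refine ((IsArithmetical.arReducible ?_).union ?_).union ?_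
  · convert h₀.isArithmetical_carrier
    exact Set.ext fun x => ⟨by rintro ⟨x, hx, rfl⟩; exact hx, fun hx => ⟨⟨x, hsub hx⟩, hx, rfl⟩⟩
  · refine arReducible_iff.2 (Dfn.congr (P := fun v =>
      MemCode (v 0) (tupleCode fun i => (a i : ℕ))) (AD.memCode (.proj 0) (AF.const _))
        fun v => ?_)
    rw [tupleCode, memCode_listCode, List.mem_ofFn]
    simp
  · refine arReducible_iff.2 (Dfn.congr (P := fun v =>
      ∃ c, c ∈ tupleSetCode X ∧ MemCode (v 0) c)
      (Dfn.ex (P := fun v c => c ∈ tupleSetCode X ∧ MemCode (v 0) c)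
        (Dfn.and (AD.mem.reindex ![0]) (AD.memCode (.proj 1) (.proj 0)))) fun v => ?_)
    constructor
    · rintro ⟨_, ⟨u, hu, i, rfl⟩, hx⟩
      exact ⟨_, ⟨u, hu, rfl⟩, memCode_listCode.2 (List.mem_ofFn.2 ⟨i, hx⟩)⟩
    · rintro ⟨_, ⟨u, hu, rfl⟩, hx⟩
      obtain ⟨i, hi⟩ := List.mem_ofFn.1 (memCode_listCode.1 hx)
      exact ⟨u i, ⟨u, hu, i, rfl⟩, hi⟩

end Degrees

/-- **Infinite definable sets recover the ambient degree**, under strongly minimal control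
over an arithmetically decidable prime model. -/
theorem infinite_definable_recovers_ambient_degree
    (L : FirstOrder.Language) (g : GoedelCoding L) (hL : ArithLang g)
    (T : L.Theory) (hT : ArithTheory g T) (hcomp : T.IsComplete)
    (hnf : NoFiniteModels L T)
    (hctrl : SMControl g T)
    (d : Set ℕ) (hd : ¬ IsArithmetical d)
    (M₀ : CodedStructure L) (h₀dec : ArithDecidable g M₀) (h₀ : M₀.Models T)
    (M : CodedStructure L) (hM : M.Models T) (hext : ArithExtendible g T M)
    (hsub : ElemSub M₀ M) (hdeg : ArEquiv M.carrier d)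
    (r s : ℕ) (a : Fin s → ↥M.carrier) (X : Set (Fin r → ↥M.carrier))
    (hXdef : DefinableOver M
      ({ x : ↥M.carrier | (x : ℕ) ∈ M₀.carrier } ∪ Set.range a) X)
    (hXinf : X.Infinite)
    (hXna : ¬ ∀ v ∈ X, ∀ i, v i ∈ aclIn L ↥M.carrier M.struc
        ({ x : ↥M.carrier | (x : ℕ) ∈ M₀.carrier } ∪ Set.range a)) :
    ArEquiv (tupleSetCode X) d := by
  obtain ⟨N, hN, -, hMN⟩ := hext
  exact ⟨(hXdef.arReducible_tupleSetCode hMN hN).trans hdeg.1,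
    hdeg.2.trans (arReducible_carrier_of_acl_eq_univ hMN hN
      (acl_union_coordSet_eq_univ hctrl h₀ hM hsub Set.subset_union_left hXdef hXna)
      (arReducible_subCode_union_coordSet h₀dec hsub.subset a X))⟩

end ArMorley
end
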